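/- arXiv:2307.07897 — 2 statements merged into one kernel-verified Lean document; each statement's English description precedes it below -/
import Mathlib

section
/- For every admissible triplet $(g,\zeta,q)$ of a finite complex reflection group $G$, there exists a set of good basic invariants, i.e. a set of basic invariants $x$ with $\frac{\partial^a x^\alpha}{\partial z^a}(q) = 0$ for all $\alpha$ and all $a \in I_\alpha^{(0)} = \{a \in \mathbb{Z}_{\geq 0}^n : a \cdot d = d_\alpha, |a| \geq 2\}$, where $z$ is a $(g,\zeta)$-graded coordinate system. -/
open MvPolynomial Matrix

noncomputable section

variable {n : ℕ}

/-- Pullback of polynomials along the linear map with matrix `M`: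
`(pback M F)(v) = F (M *ᵥ v)`.  The pullback `g^*F` of the paper is `pback (g⁻¹).val F`. -/
def pback (M : Matrix (Fin n) (Fin n) ℂ) :
    MvPolynomial (Fin n) ℂ →ₐ[ℂ] MvPolynomial (Fin n) ℂ :=
  aeval fun i => ∑ j, C (M i j) * X j

/-- Multi-index partial derivative `∂^a/∂z^a` of a polynomial (in the standard coordinates). -/
def mderiv (a : Fin n → ℕ) (F : MvPolynomial (Fin n) ℂ) : MvPolynomial (Fin n) ℂ :=
  (List.finRange n).foldr (fun i acc => (fun p => pderiv i p)^[a i] acc) F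

/-- The linear coordinate `z^α = ∑_j P_{α j} u^j` of the coordinate system given by `P`. -/
def coordPoly (P : GL (Fin n) ℂ) (α : Fin n) : MvPolynomial (Fin n) ℂ :=
  ∑ j, C (P.val α j) * X j

/-- `∂^a F/∂z^a` evaluated at `q`, where `z = P u` are the coordinates given by `P`. -/
def zderivAt (P : GL (Fin n) ℂ) (a : Fin n → ℕ) (F : MvPolynomial (Fin n) ℂ)
    (q : Fin n → ℂ) : ℂ :=
  eval (P.val *ᵥ q) (mderiv a (pback (P⁻¹).val F))

/-- `g` is a (complex) reflection: it fixes a hyperplane pointwise and is not the identity. -/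
def IsReflection (g : GL (Fin n) ℂ) : Prop :=
  g ≠ 1 ∧
    Module.finrank ℂ (LinearMap.range (Matrix.toLin' (g.val - 1))) = 1

/-- A finite complex reflection group: a finite subgroup generated by its reflections. -/
def IsReflectionGroup (G : Subgroup (GL (Fin n) ℂ)) : Prop :=
  Finite G ∧ Subgroup.closure {g | g ∈ G ∧ IsReflection g} = G

/-- A regular vector: it lies on no reflection hyperplane of `G`. -/
def IsRegularVec (G : Subgroup (GL (Fin n) ℂ)) (q : Fin n → ℂ) : Prop :=
  q ≠ 0 ∧ ∀ g ∈ G, IsReflection g → g.val *ᵥ q ≠ q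

/-- A `ζ`-regular element of `G`: its `ζ`-eigenspace contains a regular vector. -/
def IsZetaRegular (G : Subgroup (GL (Fin n) ℂ)) (g : GL (Fin n) ℂ) (ζ : ℂ) : Prop :=
  g ∈ G ∧ ∃ q, IsRegularVec G q ∧ g.val *ᵥ q = ζ • q

/-- A set of basic invariants of `G` with degrees `d`. -/
structure BasicInvariants (G : Subgroup (GL (Fin n) ℂ)) (d : Fin n → ℕ)
    (x : Fin n → MvPolynomial (Fin n) ℂ) : Prop where
  pos : ∀ α, 0 < d α
  homog : ∀ α, (x α).IsHomogeneous (d α)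
  invariant : ∀ g ∈ G, ∀ α, pback (g : GL (Fin n) ℂ).val (x α) = x α
  indep : AlgebraicIndependent ℂ x
  gen : ∀ F : MvPolynomial (Fin n) ℂ, (∀ g ∈ G, pback (g : GL (Fin n) ℂ).val F = F) →
    F ∈ Algebra.adjoin ℂ (Set.range x)

/-- An admissible triplet `(g, ζ, q)`; the degrees are arranged so that `d 0` is the highest. -/
structure AdmissibleTriplet [NeZero n] (G : Subgroup (GL (Fin n) ℂ)) (d : Fin n → ℕ)
    (g : GL (Fin n) ℂ) (ζ : ℂ) (q : Fin n → ℂ) : Prop where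
  prim : IsPrimitiveRoot ζ (d 0)
  reg : IsZetaRegular G g ζ
  regq : IsRegularVec G q
  eig : g.val *ᵥ q = ζ • q

/-- `P` gives a `(g,ζ)`-graded coordinate system: `g^* z^α = ζ^{d_α-1} z^α`. -/
def GradedCoords (g : GL (Fin n) ℂ) (ζ : ℂ) (d : Fin n → ℕ) (P : GL (Fin n) ℂ) : Prop :=
  ∀ α, pback (g⁻¹).val (coordPoly P α) = C (ζ ^ ((d α : ℤ) - 1)) * coordPoly P α

/-- The multi-index `e_β`. -/
def unitIdx (β : Fin n) : Fin n → ℕ := fun j => if j = β then 1 else 0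

/-- `x` is compatible with the coordinate system given by `P` at `q`:
`∂x^α/∂z^β (q) = δ^α_β`. -/
def Compatible (P : GL (Fin n) ℂ) (q : Fin n → ℂ)
    (x : Fin n → MvPolynomial (Fin n) ℂ) : Prop :=
  ∀ α β, zderivAt P (unitIdx β) (x α) q = if α = β then 1 else 0

/-- `x` is good: the derivatives `∂^a x^α/∂z^a` vanish at `q` for every `a ∈ I_α^{(0)}`. -/
def IsGood [NeZero n] (P : GL (Fin n) ℂ) (q : Fin n → ℂ) (d : Fin n → ℕ)
    (x : Fin n → MvPolynomial (Fin n) ℂ) : Prop :=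
  ∀ α (a : Fin n → ℕ), (∑ β, a β * d β) = d α → 2 ≤ ∑ β, a β →
    zderivAt P a (x α) q = 0

/-- Multi-index partial derivative of a function on `ℂ^n`. -/
def mpd (a : Fin n → ℕ) (f : (Fin n → ℂ) → ℂ) : (Fin n → ℂ) → ℂ :=
  (List.finRange n).foldr
    (fun i acc => (fun g v => fderiv ℂ g v (Pi.single i 1))^[a i] acc) f

/-- `f` is a rational function which is regular at `q`. -/
def RegRat (q : Fin n → ℂ) (f : (Fin n → ℂ) → ℂ) : Prop :=
  ∃ p s : MvPolynomial (Fin n) ℂ, eval q s ≠ 0 ∧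
    ∀ v, eval v s ≠ 0 → f v = eval v p / eval v s

/-- Condition `P(i)`: the value at `q` is diagonal and nonvanishing derivatives at `q`
satisfy `a·d + d_β = d_γ + k d_1` with `k ≥ i`. -/
def CondP [NeZero n] (d : Fin n → ℕ) (q : Fin n → ℂ) (i : ℕ)
    (M : Fin n → Fin n → (Fin n → ℂ) → ℂ) : Prop :=
  (∀ γ β, γ ≠ β → M γ β q = 0) ∧
    ∀ γ β (a : Fin n → ℕ), a ≠ 0 → mpd a (M γ β) q ≠ 0 →
      ∃ k : ℕ, i ≤ k ∧ (∑ α, a α * d α) + d β = d γ + k * d 0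

/-- Condition `Q(j,h)`: nonvanishing derivatives at `q` satisfy
`a·d + h + d_β = d_γ + k d_1` with `k ≥ j`. -/
def CondQ [NeZero n] (d : Fin n → ℕ) (q : Fin n → ℂ) (j h : ℕ)
    (M : Fin n → Fin n → (Fin n → ℂ) → ℂ) : Prop :=
  ∀ γ β (a : Fin n → ℕ), mpd a (M γ β) q ≠ 0 →
    ∃ k : ℕ, j ≤ k ∧ (∑ α, a α * d α) + h + d β = d γ + k * d 0

/-- Entrywise product of matrices of functions. -/
def matMulF (Xm Ym : Fin n → Fin n → (Fin n → ℂ) → ℂ) :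
    Fin n → Fin n → (Fin n → ℂ) → ℂ :=
  fun γ β v => ∑ ρ, Xm γ ρ v * Ym ρ β v

/-- The `(γ,β)` entry of the Jacobian matrix `J = (∂x^γ/∂z^β)`, expressed in the
coordinates `z = P u`, as a function on coordinate space. -/
def jacEntry (P : GL (Fin n) ℂ) (x : Fin n → MvPolynomial (Fin n) ℂ) (γ β : Fin n) :
    (Fin n → ℂ) → ℂ :=
  fun v => eval v (pderiv β (pback (P⁻¹).val (x γ)))

/-- Evaluation at `q + ε u` in the dual numbers. -/
def dn (q u : Fin n → ℂ) : MvPolynomial (Fin n) ℂ →ₐ[ℂ] DualNumber ℂ :=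
  aeval fun i => TrivSqZeroExt.inl (q i) + TrivSqZeroExt.inr (u i)

lemma dn_X (q u : Fin n → ℂ) (i : Fin n) :
    dn q u (X i) = TrivSqZeroExt.inl (q i) + TrivSqZeroExt.inr (u i) := by
  simp [dn]

lemma dn_C (q u : Fin n → ℂ) (c : ℂ) :
    dn q u (C c) = TrivSqZeroExt.inl c := by
  simp [dn]; rfl

@[simp] lemma fst_algMap (c : ℂ) :
    TrivSqZeroExt.fst (algebraMap ℂ (DualNumber ℂ) c) = c := rfl

@[simp] lemma snd_algMap (c : ℂ) :
    TrivSqZeroExt.snd (algebraMap ℂ (DualNumber ℂ) c) = 0 := rfl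

lemma dn_pback (q u : Fin n → ℂ) (M : Matrix (Fin n) (Fin n) ℂ) (F : MvPolynomial (Fin n) ℂ) :
    dn q u (pback M F) = dn (M *ᵥ q) (M *ᵥ u) F := by
  have : (dn q u).comp (pback M) = dn (M *ᵥ q) (M *ᵥ u) := by
    apply MvPolynomial.algHom_ext
    intro i
    simp only [AlgHom.comp_apply, pback, aeval_X, map_sum, map_mul, dn_X, dn_C]
    ext
    · rw [TrivSqZeroExt.fst_sum]
      simp [Matrix.mulVec, dotProduct]
    · rw [TrivSqZeroExt.snd_sum]
      simp [Matrix.mulVec, dotProduct]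
  rw [← this]; rfl

lemma eval_pback (q : Fin n → ℂ) (M : Matrix (Fin n) (Fin n) ℂ) (F : MvPolynomial (Fin n) ℂ) :
    eval q (pback M F) = eval (M *ᵥ q) F := by
  have : (aeval q).comp (pback M) = (aeval (M *ᵥ q) : MvPolynomial (Fin n) ℂ →ₐ[ℂ] ℂ) := by
    apply MvPolynomial.algHom_ext
    intro i
    simp [pback, Matrix.mulVec, dotProduct]
  have := DFunLike.congr_fun this F
  simpa [aeval_eq_eval] using this

lemma fst_dn (q u : Fin n → ℂ) (F : MvPolynomial (Fin n) ℂ) :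
    TrivSqZeroExt.fst (dn q u F) = eval q F := by
  induction F using MvPolynomial.induction_on with
  | C a => simp [dn_C]
  | add p q hp hq => simp [hp, hq]
  | mul_X p i hp => simp [hp, dn_X]

lemma snd_dn (q u : Fin n → ℂ) (F : MvPolynomial (Fin n) ℂ) :
    TrivSqZeroExt.snd (dn q u F) = ∑ i, eval q (pderiv i F) * u i := by
  induction F using MvPolynomial.induction_on with
  | C a => simp [dn_C]
  | add p q hp hq => simp [hp, hq, add_mul, Finset.sum_add_distrib]
  | mul_X p i hp =>
    have h1 : ∀ j, eval q (pderiv j (p * X i)) * u j =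
        q i * (eval q (pderiv j p) * u j) + if j = i then eval q p * u i else 0 := by
      intro j
      rw [pderiv_mul, pderiv_X]
      by_cases hji : j = i
      · subst hji; simp; ring
      · simp [hji]; ring
    simp only [h1, Finset.sum_add_distrib, ← Finset.mul_sum, ← hp]
    simp [dn_X, fst_dn]
    ring

/-- If the differentials of the invariants are dependent at `q`, then `q` has a nontrivial
stabilizer. -/
lemma exists_stab (G : Subgroup (GL (Fin n) ℂ)) [Finite G] (d : Fin n → ℕ)
    (x : Fin n → MvPolynomial (Fin n) ℂ) (hx : BasicInvariants G d x)
    (q u : Fin n → ℂ) (hu : u ≠ 0) (h : ∀ α, TrivSqZeroExt.snd (dn q u (x α)) = 0) :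
    ∃ g ∈ G, g ≠ 1 ∧ g.val *ᵥ q = q := by
  classical
  by_contra hcon
  push Not at hcon
  have := Fintype.ofFinite G
  obtain ⟨k, hk⟩ := Function.ne_iff.mp hu
  have hadj : ∀ F ∈ Algebra.adjoin ℂ (Set.range x), TrivSqZeroExt.snd (dn q u F) = 0 := by
    intro F hF
    induction hF using Algebra.adjoin_induction with
    | mem y hy => obtain ⟨α, rfl⟩ := hy; exact h α
    | algebraMap r =>
      rw [MvPolynomial.algebraMap_eq, dn_C]; simp
    | add y z _ _ hy hz => simp [hy, hz]
    | mul y z _ _ hy hz => simp [hy, hz]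
  have hch : ∀ g : G, g ≠ 1 → ∃ i, (g.1.val *ᵥ q) i ≠ q i := by
    intro g hg
    exact Function.ne_iff.mp (hcon g.1 g.2 (by simpa using hg))
  have hch' : ∀ g : G, ∃ i, g ≠ 1 → (g.1.val *ᵥ q) i ≠ q i := by
    intro g
    by_cases hg : g = 1
    · exact ⟨k, fun h => absurd hg h⟩
    · obtain ⟨i, hi⟩ := hch g hg
      exact ⟨i, fun _ => hi⟩
  choose r hr using hch'
  let m : G → MvPolynomial (Fin n) ℂ := fun g => X (r g) - C ((g.1.val *ᵥ q) (r g))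
  let p : MvPolynomial (Fin n) ℂ := (X k - C (q k)) * ∏ g ∈ Finset.univ.erase (1 : G), m g ^ 2
  let F : MvPolynomial (Fin n) ℂ := ∑ g : G, pback g.1.val p
  have hF : ∀ g ∈ G, pback (g : GL (Fin n) ℂ).val F = F := by
    intro g hg
    have hcomp : ∀ (M N : Matrix (Fin n) (Fin n) ℂ) (f : MvPolynomial (Fin n) ℂ),
        pback M (pback N f) = pback (N * M) f := by
      intro M N f
      apply MvPolynomial.funext
      intro v
      simp [eval_pback, Matrix.mulVec_mulVec]
    simp only [F, map_sum, hcomp]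
    exact Fintype.sum_equiv (Equiv.mulRight (⟨g, hg⟩ : G)) _ _ (fun y => by simp)
  have hF0 := hadj F (hx.gen F hF)
  simp only [F, map_sum, dn_pback] at hF0
  rw [TrivSqZeroExt.snd_sum, Finset.sum_eq_single (1 : G)] at hF0
  · simp only [p, map_mul, map_prod, map_pow] at hF0
    rw [TrivSqZeroExt.snd_mul] at hF0
    simp [dn_X] at hF0
    rcases hF0 with hF0 | hF0
    rotate_left
    · rw [← TrivSqZeroExt.fstHom_apply ℂ, map_prod, Finset.prod_eq_zero_iff] at hF0
      obtain ⟨g, hg, hg0⟩ := hF0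
      simp [m, dn_X, dn_C] at hg0
      apply hr g (by simpa using hg)
      rw [sub_eq_zero] at hg0
      exact hg0.symm
    · exact hk (by simpa using hF0)
  · intro g _ hg
    have : dn (g.1.val *ᵥ q) (g.1.val *ᵥ u) p = 0 := by
      simp only [p, map_mul, map_prod, map_pow]
      rw [Finset.prod_eq_zero (i := g)]
      · simp
      · simp [hg]
      · simp only [m, map_sub, dn_X, dn_C]
        rw [add_sub_cancel_left, sq, TrivSqZeroExt.inr_mul_inr]
    rw [this]; simp
  · simp

lemma exists_prime_factor (q : Fin n → ℂ) (a : MvPolynomial (Fin n) ℂ) :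
    a ≠ 0 → eval q a = 0 → ∃ f, Prime f ∧ f ∣ a ∧ eval q f = 0 := by
  induction a using UniqueFactorizationMonoid.induction_on_prime with
  | h₁ => intro h; exact absurd rfl h
  | h₂ u hu =>
    intro _ h0
    have := hu.map (eval q)
    rw [h0] at this
    simp at this
  | h₃ a p ha hp ih =>
    intro _ h0
    rw [map_mul, mul_eq_zero] at h0
    rcases h0 with h0 | h0
    · exact ⟨p, hp, dvd_mul_right _ _, h0⟩
    · obtain ⟨f, h1, h2, h3⟩ := ih ha h0
      exact ⟨f, h1, h2.mul_left _, h3⟩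

/-- The linear form given by the `i`-th row of `M`. -/
def rowForm (M : Matrix (Fin n) (Fin n) ℂ) (i : Fin n) : MvPolynomial (Fin n) ℂ :=
  ∑ j, C (M i j) * X j

lemma eval_rowForm (M : Matrix (Fin n) (Fin n) ℂ) (i : Fin n) (v : Fin n → ℂ) :
    eval v (rowForm M i) = (M *ᵥ v) i := by
  simp [rowForm, Matrix.mulVec, dotProduct]

lemma coeff_rowForm (M : Matrix (Fin n) (Fin n) ℂ) (i j : Fin n) :
    coeff (Finsupp.single j 1) (rowForm M i) = M i j := by
  classical
  simp [rowForm, coeff_sum, coeff_X, Finsupp.single_left_inj]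

lemma totalDegree_rowForm (M : Matrix (Fin n) (Fin n) ℂ) (i : Fin n) :
    (rowForm M i).totalDegree ≤ 1 := by
  apply (IsHomogeneous.totalDegree_le)
  apply IsHomogeneous.sum
  intro j _
  simpa using (isHomogeneous_C (Fin n) (M i j)).mul (isHomogeneous_X ℂ j)

lemma factor_const (f h L : MvPolynomial (Fin n) ℂ) (hf : Prime f) (hL : L = f * h)
    (hd : L.totalDegree ≤ 1) : ∃ c, h = C c := by
  by_cases h0 : h = 0
  · exact ⟨0, by simp [h0]⟩
  rw [hL, totalDegree_mul_of_isDomain hf.ne_zero h0] at hd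
  have : f.totalDegree ≠ 0 := by
    intro hf0
    rw [totalDegree_eq_zero_iff_eq_C] at hf0
    apply hf.not_isUnit
    rw [hf0]
    apply IsUnit.map
    rw [isUnit_iff_ne_zero]
    intro h1
    rw [h1] at hf0
    exact hf.ne_zero (by simpa using hf0)
  exact ⟨_, totalDegree_eq_zero_iff_eq_C.mp (by omega)⟩

/-- If all rows of `g - 1` are divisible by a prime `f`, then `g` is a reflection. -/
lemma isReflection_of_dvd (g : GL (Fin n) ℂ) (hg : g ≠ 1) (f : MvPolynomial (Fin n) ℂ)
    (hf : Prime f) (h : ∀ i, f ∣ rowForm (g.val - 1) i) : IsReflection g := by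
  refine ⟨hg, ?_⟩
  choose k hk using h
  have : ∀ i, ∃ c, k i = C c := fun i => factor_const f (k i) _ hf (hk i) (totalDegree_rowForm _ _)
  choose c hc using this
  have hM : g.val - 1 = Matrix.vecMulVec c (fun j => coeff (Finsupp.single j 1) f) := by
    ext i j
    rw [← coeff_rowForm (g.val - 1) i j, hk, hc, mul_comm, coeff_C_mul, Matrix.vecMulVec_apply]
  have h1 : (g.val - 1).rank ≤ 1 := by
    rw [hM]; exact Matrix.rank_vecMulVec_le _ _
  have h2 : Module.finrank ℂ (LinearMap.range (Matrix.toLin' (g.val - 1))) = (g.val - 1).rank := by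
    rw [Matrix.rank, Matrix.toLin'_apply']
  rw [h2]
  have h3 : (g.val - 1).rank ≠ 0 := by
    intro h0
    rw [← h2, Submodule.finrank_eq_zero, LinearMap.range_eq_bot, LinearEquiv.map_eq_zero_iff] at h0
    apply hg
    ext1
    simpa [sub_eq_zero] using h0
  omega

/-- At a regular vector the differentials of the basic invariants are independent. -/
lemma jac_regular (G : Subgroup (GL (Fin n) ℂ)) [Finite G] (d : Fin n → ℕ)
    (x : Fin n → MvPolynomial (Fin n) ℂ) (hx : BasicInvariants G d x)
    (q u : Fin n → ℂ) (hq : IsRegularVec G q)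
    (h : ∀ α, TrivSqZeroExt.snd (dn q u (x α)) = 0) : u = 0 := by
  classical
  by_contra hu
  have := Fintype.ofFinite G
  let Jm : Matrix (Fin n) (Fin n) (MvPolynomial (Fin n) ℂ) := fun α i => pderiv i (x α)
  have hdet : ∀ v, eval v Jm.det = 0 ↔
      ∃ u : Fin n → ℂ, u ≠ 0 ∧ ∀ α, TrivSqZeroExt.snd (dn v u (x α)) = 0 := by
    intro v
    rw [RingHom.map_det, ← Matrix.exists_mulVec_eq_zero_iff]
    simp only [snd_dn, funext_iff]
    rfl
  have hstab : ∀ v, eval v Jm.det = 0 → ∃ g ∈ G, g ≠ 1 ∧ g.val *ᵥ v = v := by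
    intro v hv
    obtain ⟨w, hw, hw'⟩ := (hdet v).mp hv
    exact exists_stab G d x hx v w hw hw'
  have hprod : ∀ (r : G → Fin n) v, eval v Jm.det = 0 →
      eval v (∏ g ∈ Finset.univ.erase (1 : G), rowForm (g.1.val - 1) (r g)) = 0 := by
    intro r v hv
    obtain ⟨g, hg, hg1, hgv⟩ := hstab v hv
    rw [map_prod]
    apply Finset.prod_eq_zero (i := (⟨g, hg⟩ : G))
    · simp only [Finset.mem_erase, Finset.mem_univ, and_true]
      intro hh
      exact hg1 (congrArg Subtype.val hh)
    · rw [eval_rowForm, Matrix.sub_mulVec]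
      simp [hgv]
  obtain ⟨k, hk⟩ := Function.ne_iff.mp hu
  have hJ0 : Jm.det ≠ 0 := by
    intro h0
    have : ∀ g : G, ∃ i, g ≠ 1 → rowForm (g.1.val - 1) i ≠ 0 := by
      intro g
      by_contra hc
      push Not at hc
      apply (hc k).1
      ext1
      ext1
      ext i j
      have := congrArg (coeff (Finsupp.single j 1)) (hc i).2
      rw [coeff_rowForm] at this
      simpa [sub_eq_zero] using this
    choose r hr using this
    have h1 : (∏ g ∈ Finset.univ.erase (1 : G), rowForm (g.1.val - 1) (r g)) = 0 := by
      apply MvPolynomial.funext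
      intro v
      rw [hprod r v (by simp [h0])]
      simp
    rw [Finset.prod_eq_zero_iff] at h1
    obtain ⟨g, hg, hg0⟩ := h1
    exact hr g (by simpa using hg) hg0
  obtain ⟨f, hf, hfd, hfq⟩ := exists_prime_factor q _ hJ0 ((hdet q).mpr ⟨u, hu, h⟩)
  have hdvd : ∀ r : G → Fin n, ∃ g : G, g ≠ 1 ∧ f ∣ rowForm (g.1.val - 1) (r g) := by
    intro r
    have hmem : (∏ g ∈ Finset.univ.erase (1 : G), rowForm (g.1.val - 1) (r g)) ∈
        vanishingIdeal ℂ (zeroLocus ℂ (Ideal.span {f})) := by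
      rw [mem_vanishingIdeal_iff]
      intro v hv
      rw [aeval_eq_eval]
      apply hprod
      have := hv f (Ideal.subset_span rfl)
      rw [aeval_eq_eval] at this
      obtain ⟨t, ht⟩ := hfd
      rw [ht, map_mul]
      simp only [this, zero_mul]
    rw [vanishingIdeal_zeroLocus_eq_radical,
      ((Ideal.span_singleton_prime hf.ne_zero).mpr hf).radical, Ideal.mem_span_singleton,
      hf.dvd_finsetProd_iff] at hmem
    obtain ⟨g, hg, hg'⟩ := hmem
    exact ⟨g, by simpa using hg, hg'⟩
  have hall : ∃ g : G, g ≠ 1 ∧ ∀ i, f ∣ rowForm (g.1.val - 1) i := by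
    by_contra hc
    push Not at hc
    have : ∀ g : G, ∃ i, g ≠ 1 → ¬ f ∣ rowForm (g.1.val - 1) i := by
      intro g
      by_cases hg : g = 1
      · exact ⟨k, fun h => absurd hg h⟩
      · obtain ⟨i, hi⟩ := hc g hg
        exact ⟨i, fun _ => hi⟩
    choose r hr using this
    obtain ⟨g, hg, hg'⟩ := hdvd r
    exact hr g hg hg'
  obtain ⟨g, hg, hgf⟩ := hall
  have href := isReflection_of_dvd g.1 (by simpa using hg) f hf hgf
  apply hq.2 g.1 g.2 href
  ext i
  obtain ⟨t, ht⟩ := hgf i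
  have := congrArg (eval q) ht
  rw [eval_rowForm, map_mul, hfq, zero_mul, Matrix.sub_mulVec] at this
  simpa [sub_eq_zero] using this


/-- Taylor shift of polynomials. -/
def shift (c : Fin n → ℂ) : MvPolynomial (Fin n) ℂ →ₐ[ℂ] MvPolynomial (Fin n) ℂ :=
  aeval fun i => X i + C (c i)

lemma pderiv_shift (c : Fin n → ℂ) (i : Fin n) (F : MvPolynomial (Fin n) ℂ) :
    shift c (pderiv i F) = pderiv i (shift c F) := by
  classical
  induction F using MvPolynomial.induction_on with
  | C a => simp [shift, MvPolynomial.algebraMap_eq]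
  | add p q hp hq => simp [hp, hq]
  | mul_X p j hp =>
    have hX : shift c (X j) = X j + C (c j) := by simp [shift]
    have hd : shift c (pderiv i (X j)) = pderiv i (shift c (X j)) := by
      rw [hX, pderiv_X]
      by_cases h : j = i
      · subst h; simp
      · simp [pderiv_X, Ne.symm h, h]
    rw [pderiv_mul, map_add, map_mul, map_mul, map_mul, pderiv_mul, hp, hd]

lemma eval_shift (c : Fin n → ℂ) (F : MvPolynomial (Fin n) ℂ) :
    coeff 0 (shift c F) = eval c F := by
  induction F using MvPolynomial.induction_on with
  | C a => simp [shift, MvPolynomial.algebraMap_eq]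
  | add p q hp hq => simp [hp, hq]
  | mul_X p j hp =>
    have hX : shift c (X j) = X j + C (c j) := by simp [shift]
    rw [map_mul, hX, ← MvPolynomial.constantCoeff_eq] at *
    simp [hp]

lemma dn_shift (c v : Fin n → ℂ) (F : MvPolynomial (Fin n) ℂ) :
    dn 0 v (shift c F) = dn c v F := by
  have : (dn 0 v).comp (shift c) = dn c v := by
    apply MvPolynomial.algHom_ext
    intro i
    simp only [AlgHom.comp_apply, shift, aeval_X, map_add, dn_X, dn_C]
    simp [add_comm]
  rw [← this]; rfl

lemma snd_dn_zero (v : Fin n → ℂ) (F : MvPolynomial (Fin n) ℂ) :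
    TrivSqZeroExt.snd (dn 0 v F) = ∑ i, coeff (Finsupp.single i 1) F * v i := by
  rw [snd_dn]
  apply Finset.sum_congr rfl
  intro i _
  congr 1
  have h0 : eval (0 : Fin n → ℂ) (pderiv i F) = coeff 0 (pderiv i F) := by
    rw [← MvPolynomial.constantCoeff_eq, ← MvPolynomial.eval_zero]
  rw [h0, coeff_pderiv]
  simp

lemma iter_shift (c : Fin n → ℂ) (i : Fin n) (k : ℕ) (F : MvPolynomial (Fin n) ℂ) :
    shift c ((fun p => pderiv i p)^[k] F) = (fun p => pderiv i p)^[k] (shift c F) := by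
  induction k with
  | zero => simp
  | succ k ih => rw [Function.iterate_succ_apply', Function.iterate_succ_apply', pderiv_shift, ih]

lemma mderiv_shift (c : Fin n → ℂ) (a : Fin n → ℕ) (F : MvPolynomial (Fin n) ℂ) :
    shift c (mderiv a F) = mderiv a (shift c F) := by
  unfold mderiv
  induction List.finRange n with
  | nil => simp
  | cons i l ih => rw [List.foldr_cons, List.foldr_cons, iter_shift, ih]

lemma coeff_iter (i : Fin n) (k : ℕ) (F : MvPolynomial (Fin n) ℂ) (m : Fin n →₀ ℕ)
    (h : coeff (m + Finsupp.single i k) F = 0) :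
    coeff m ((fun p => pderiv i p)^[k] F) = 0 := by
  induction k generalizing m with
  | zero => simpa using h
  | succ k ih =>
    rw [Function.iterate_succ_apply', coeff_pderiv, ih, zero_mul]
    rwa [add_assoc, ← Finsupp.single_add, add_comm 1 k]

lemma coeff_fold (a : Fin n → ℕ) (l : List (Fin n)) (F : MvPolynomial (Fin n) ℂ) (m : Fin n →₀ ℕ)
    (h : coeff (m + (l.map fun i => Finsupp.single i (a i)).sum) F = 0) :
    coeff m (l.foldr (fun i acc => (fun p => pderiv i p)^[a i] acc) F) = 0 := by
  induction l generalizing m with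
  | nil => simpa using h
  | cons i l ih =>
    rw [List.foldr_cons]
    apply coeff_iter
    apply ih
    rwa [add_assoc, ← List.sum_cons, ← List.map_cons (f := fun i => Finsupp.single i (a i))]

lemma coeff_mderiv (a : Fin n →₀ ℕ) (F : MvPolynomial (Fin n) ℂ) (h : coeff a F = 0) :
    coeff 0 (mderiv a F) = 0 := by
  apply coeff_fold
  have : ((List.finRange n).map fun i => Finsupp.single i (a i)).sum = a := by
    have h1 := Fin.sum_univ_def (fun i => Finsupp.single i (a i))
    rw [← h1, Finsupp.univ_sum_single]
  rwa [this, zero_add]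

/-- Taylor expansion at `q` in the coordinates `z`. -/
def taylor (P : GL (Fin n) ℂ) (q : Fin n → ℂ) :
    MvPolynomial (Fin n) ℂ →ₐ[ℂ] MvPolynomial (Fin n) ℂ :=
  (shift (P.val *ᵥ q)).comp (pback (P⁻¹).val)

lemma zderivAt_eq_zero (P : GL (Fin n) ℂ) (q : Fin n → ℂ) (a : Fin n →₀ ℕ)
    (F : MvPolynomial (Fin n) ℂ) (h : coeff a (taylor P q F) = 0) : zderivAt P a F q = 0 := by
  unfold zderivAt
  rw [← eval_shift, mderiv_shift]
  exact coeff_mderiv a _ h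

lemma inv_mulVec_mulVec (P : GL (Fin n) ℂ) (q : Fin n → ℂ) :
    (P⁻¹).val *ᵥ (P.val *ᵥ q) = q := by
  rw [Matrix.mulVec_mulVec, ← Units.val_mul]; simp

lemma mulVec_inv_mulVec (P : GL (Fin n) ℂ) (q : Fin n → ℂ) :
    P.val *ᵥ ((P⁻¹).val *ᵥ q) = q := by
  rw [Matrix.mulVec_mulVec, ← Units.val_mul]; simp

lemma coeff_zero_taylor (P : GL (Fin n) ℂ) (q : Fin n → ℂ) (F : MvPolynomial (Fin n) ℂ) :
    coeff 0 (taylor P q F) = eval q F := by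
  rw [taylor, AlgHom.comp_apply, eval_shift, eval_pback, inv_mulVec_mulVec]

lemma dn_taylor (P : GL (Fin n) ℂ) (q v : Fin n → ℂ) (F : MvPolynomial (Fin n) ℂ) :
    dn 0 v (taylor P q F) = dn q ((P⁻¹).val *ᵥ v) F := by
  rw [taylor, AlgHom.comp_apply, dn_shift, dn_pback, inv_mulVec_mulVec]

lemma pback_smul (c : ℂ) (e : ℕ) (F : MvPolynomial (Fin n) ℂ) (hF : F.IsHomogeneous e) :
    pback (c • (1 : Matrix (Fin n) (Fin n) ℂ)) F = C (c ^ e) * F := by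
  have h1 : pback (c • (1 : Matrix (Fin n) (Fin n) ℂ)) = aeval fun i => C c * X i := by
    apply MvPolynomial.algHom_ext
    intro i
    simp only [pback, aeval_X, Matrix.smul_apply, Matrix.one_apply, smul_eq_mul, mul_ite, mul_one, mul_zero]
    rw [Finset.sum_eq_single i]
    · simp
    · intro j _ hj; simp [hj.symm]
    · simp
  rw [h1]
  conv_lhs => rw [F.as_sum]
  conv_rhs => rw [F.as_sum]
  rw [map_sum, Finset.mul_sum]
  apply Finset.sum_congr rfl
  intro b hb
  have hb' : ∑ i, b i = e := by
    rw [← Finsupp.degree_eq_sum]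
    have := hF (mem_support_iff.mp hb)
    rw [Finsupp.degree_eq_weight_one]
    exact this
  rw [aeval_monomial, Finsupp.prod_fintype _ _ (by simp), MvPolynomial.algebraMap_eq,
    monomial_eq, Finsupp.prod_fintype _ _ (by simp)]
  simp only [mul_pow, Finset.prod_mul_distrib, Finset.prod_pow_eq_pow_sum, hb', C_pow]
  ring

lemma snd_dn_smul (c : ℂ) (q u : Fin n → ℂ) (F : MvPolynomial (Fin n) ℂ) :
    TrivSqZeroExt.snd (dn q (c • u) F) = c * TrivSqZeroExt.snd (dn q u F) := by
  simp only [snd_dn, Finset.mul_sum]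
  apply Finset.sum_congr rfl
  intros
  simp; ring

lemma dn_smul_smul (c : ℂ) (e : ℕ) (q u : Fin n → ℂ) (F : MvPolynomial (Fin n) ℂ)
    (hF : F.IsHomogeneous e) :
    TrivSqZeroExt.snd (dn (c • q) (c • u) F) = c ^ e * TrivSqZeroExt.snd (dn q u F) := by
  have := dn_pback q u (c • (1 : Matrix (Fin n) (Fin n) ℂ)) F
  rw [pback_smul c e F hF] at this
  simp only [Matrix.smul_mulVec, Matrix.one_mulVec] at this
  rw [← this, map_mul, dn_C]
  simp

lemma eval_smul_vec (c : ℂ) (e : ℕ) (q : Fin n → ℂ) (F : MvPolynomial (Fin n) ℂ)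
    (hF : F.IsHomogeneous e) : eval (c • q) F = c ^ e * eval q F := by
  have := eval_pback q (c • (1 : Matrix (Fin n) (Fin n) ℂ)) F
  rw [pback_smul c e F hF] at this
  simp only [Matrix.smul_mulVec, Matrix.one_mulVec] at this
  rw [← this]; simp

lemma graded_eig (g P : GL (Fin n) ℂ) (ζ : ℂ) (hζ : ζ ≠ 0) (d : Fin n → ℕ)
    (hP : GradedCoords g ζ d P) (β : Fin n) :
    g.val *ᵥ ((P⁻¹).val *ᵥ Pi.single β 1) =
      (ζ ^ (1 - (d β : ℤ))) • ((P⁻¹).val *ᵥ Pi.single β 1) := by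
  set u := (P⁻¹).val *ᵥ Pi.single β 1 with hu
  have key : P.val *ᵥ (g.val *ᵥ u) = (ζ ^ (1 - (d β : ℤ))) • Pi.single β 1 := by
    ext α
    have h := congrArg (eval (g.val *ᵥ u)) (hP α)
    have h2 : ∀ v, eval v (coordPoly P α) = (P.val *ᵥ v) α := fun v => eval_rowForm P.val α v
    rw [eval_pback, map_mul, eval_C, h2, h2, inv_mulVec_mulVec, hu, mulVec_inv_mulVec] at h
    rw [← hu] at h
    by_cases hαβ : α = β
    · subst hαβ
      simp only [Pi.single_eq_same, Pi.smul_apply, smul_eq_mul, mul_one] at h ⊢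
      rw [← neg_sub, _root_.zpow_neg]
      exact eq_inv_of_mul_eq_one_right h.symm
    · simp [hαβ, zpow_ne_zero _ hζ] at h ⊢
      exact h
  have := congrArg (fun v => (P⁻¹).val *ᵥ v) key
  simp only [inv_mulVec_mulVec, Matrix.mulVec_smul] at this
  exact this

lemma taylor_linear (G : Subgroup (GL (Fin n) ℂ)) [NeZero n] (d : Fin n → ℕ) (hd : Antitone d)
    (x : Fin n → MvPolynomial (Fin n) ℂ) (hx : BasicInvariants G d x)
    (g : GL (Fin n) ℂ) (ζ : ℂ) (q : Fin n → ℂ) (hT : AdmissibleTriplet G d g ζ q)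
    (P : GL (Fin n) ℂ) (hP : GradedCoords g ζ d P) (α β : Fin n)
    (h : coeff (Finsupp.single β 1) (taylor P q (x α)) ≠ 0) : d α = d β := by
  classical
  have hζ : ζ ≠ 0 := hT.prim.ne_zero (hx.pos 0).ne'
  have hc : coeff (Finsupp.single β 1) (taylor P q (x α)) =
      TrivSqZeroExt.snd (dn q ((P⁻¹).val *ᵥ Pi.single β 1) (x α)) := by
    rw [← dn_taylor, snd_dn_zero]
    simp [Pi.single_apply]
  rw [hc] at h
  have h1 := dn_pback q ((P⁻¹).val *ᵥ Pi.single β 1) g.val (x α)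
  rw [hx.invariant g hT.reg.1 α, hT.eig, graded_eig g P ζ hζ d hP β] at h1
  have h2 : ζ ^ (1 - (d β : ℤ)) = ζ * ζ ^ (-(d β : ℤ)) := by
    rw [sub_eq_add_neg, zpow_add₀ hζ, zpow_one]
  rw [h2, mul_smul] at h1
  have h3 := congrArg TrivSqZeroExt.snd h1
  rw [dn_smul_smul _ _ _ _ _ (hx.homog α), snd_dn_smul, ← mul_assoc] at h3
  have h4 : ζ ^ d α * ζ ^ (-(d β : ℤ)) = 1 := by
    have : (ζ ^ d α * ζ ^ (-(d β : ℤ)) - 1) *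
      TrivSqZeroExt.snd (dn q ((P⁻¹).val *ᵥ Pi.single β 1) (x α)) = 0 := by
      rw [sub_mul, ← h3]; ring
    rcases mul_eq_zero.mp this with h5 | h5
    · exact sub_eq_zero.mp h5
    · exact absurd h5 h
  rw [← zpow_natCast, ← zpow_add₀ hζ, hT.prim.zpow_eq_one_iff_dvd] at h4
  have ha := hd (Fin.zero_le α)
  have hb := hd (Fin.zero_le β)
  have pa := hx.pos α
  have pb := hx.pos β
  have h5 := Int.eq_zero_of_abs_lt_dvd h4 (by rw [abs_lt]; omega)
  omega

lemma taylor_const (G : Subgroup (GL (Fin n) ℂ)) [NeZero n] (d : Fin n → ℕ)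
    (x : Fin n → MvPolynomial (Fin n) ℂ) (hx : BasicInvariants G d x)
    (g : GL (Fin n) ℂ) (ζ : ℂ) (q : Fin n → ℂ) (hT : AdmissibleTriplet G d g ζ q)
    (P : GL (Fin n) ℂ) (α : Fin n) (h : d α < d 0) : coeff 0 (taylor P q (x α)) = 0 := by
  rw [coeff_zero_taylor]
  have h1 := eval_pback q g.val (x α)
  rw [hx.invariant g hT.reg.1 α, hT.eig, eval_smul_vec _ _ _ _ (hx.homog α)] at h1
  by_contra hne
  have h2 : ζ ^ d α = 1 := by
    apply mul_right_cancel₀ hne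
    rw [one_mul]; exact h1.symm
  have := Nat.le_of_dvd (hx.pos α) (hT.prim.dvd_of_pow_eq_one _ h2)
  omega

lemma taylor_det (G : Subgroup (GL (Fin n) ℂ)) [Finite G] (d : Fin n → ℕ)
    (x : Fin n → MvPolynomial (Fin n) ℂ) (hx : BasicInvariants G d x)
    (q : Fin n → ℂ) (hq : IsRegularVec G q) (P : GL (Fin n) ℂ) :
    (Matrix.of fun α β => coeff (Finsupp.single β 1) (taylor P q (x α))).det ≠ 0 := by
  intro h0
  obtain ⟨v, hv, hv0⟩ := Matrix.exists_mulVec_eq_zero_iff.mpr h0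
  have := jac_regular G d x hx q ((P⁻¹).val *ᵥ v) hq (by
    intro α
    rw [← dn_taylor, snd_dn_zero]
    exact congrFun hv0 α)
  apply hv
  rw [← mulVec_inv_mulVec P v, this]
  simp

/-- The index set `I_α^{(0)}` (with `D = d_α`). -/
def idx (d : Fin n → ℕ) (D : ℕ) : Set (Fin n →₀ ℕ) :=
  {b | Finsupp.weight d b = D ∧ 2 ≤ Finsupp.degree b}

lemma idx_finite (d : Fin n → ℕ) (hd : ∀ i, 0 < d i) (D : ℕ) : (idx d D).Finite :=
  (Finsupp.finite_of_nat_weight_eq d (fun i => (hd i).ne') D).subset fun _ hb => hb.1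

lemma exists_single_add (b : Fin n →₀ ℕ) (i : Fin n) (hi : b i ≠ 0) :
    ∃ b', b = Finsupp.single i 1 + b' := by
  obtain ⟨c, hc⟩ := le_iff_exists_add.mp (show Finsupp.single i 1 ≤ b by
    rw [Finsupp.single_le_iff]; omega)
  exact ⟨c, hc⟩

lemma idx_lt (d : Fin n → ℕ) (hd : ∀ i, 0 < d i) (D : ℕ) (b : Fin n →₀ ℕ) (hb : b ∈ idx d D)
    (i : Fin n) (hi : b i ≠ 0) : d i < D := by
  obtain ⟨b', rfl⟩ := exists_single_add b i hi
  obtain ⟨h1, h2⟩ := hb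
  rw [map_add, Finsupp.weight_single] at h1
  rw [map_add, Finsupp.degree_single] at h2
  have h3 : b' ≠ 0 := by
    rintro rfl
    simp at h2
  obtain ⟨j, hj⟩ := Finsupp.ne_iff.mp h3
  have h4 := Finsupp.le_weight_of_ne_zero' d hj
  have := hd j
  simp at h1
  omega

lemma whom_aeval (d w : Fin n → ℕ) (D : ℕ) (f : Fin n → MvPolynomial (Fin n) ℂ)
    (hf : ∀ i, IsWeightedHomogeneous w (f i) (d i)) (Q : MvPolynomial (Fin n) ℂ)
    (hQ : ∀ b ∈ Q.support, Finsupp.weight d b = D) :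
    IsWeightedHomogeneous w (aeval f Q) D := by
  rw [Q.as_sum, map_sum]
  apply IsWeightedHomogeneous.sum
  intro b hb
  rw [aeval_monomial, Finsupp.prod_fintype _ _ (by simp), ← hQ b hb, Finsupp.weight_eq_sum,
    ← zero_add (∑ i, b i • d i)]
  apply IsWeightedHomogeneous.mul
  · exact isWeightedHomogeneous_C _ _
  · apply IsWeightedHomogeneous.prod
    intro i _
    exact (hf i).pow (b i)

lemma aeval_mem_pow (f : Fin n → MvPolynomial (Fin n) ℂ)
    (hf : ∀ i, f i ∈ idealOfVars (Fin n) ℂ) (k : ℕ) (Q : MvPolynomial (Fin n) ℂ)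
    (hQ : Q ∈ idealOfVars (Fin n) ℂ ^ k) : aeval f Q ∈ idealOfVars (Fin n) ℂ ^ k := by
  have h1 := Ideal.mem_map_of_mem (aeval f : MvPolynomial (Fin n) ℂ →ₐ[ℂ] _) hQ
  rw [Ideal.map_pow] at h1
  refine Ideal.pow_right_mono ?_ k h1
  rw [Ideal.map_span, Ideal.span_le]
  rintro _ ⟨_, ⟨i, rfl⟩, rfl⟩
  simpa using hf i

lemma aeval_diff_monomial (f₁ f₂ : Fin n → MvPolynomial (Fin n) ℂ)
    (h₁ : ∀ i, f₁ i ∈ idealOfVars (Fin n) ℂ) (h₂ : ∀ i, f₂ i ∈ idealOfVars (Fin n) ℂ)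
    (h : ∀ i, f₁ i - f₂ i ∈ idealOfVars (Fin n) ℂ ^ 2) (k : ℕ) :
    ∀ b : Fin n →₀ ℕ, Finsupp.degree b = k →
      aeval f₁ (monomial b (1 : ℂ)) - aeval f₂ (monomial b (1 : ℂ)) ∈
        idealOfVars (Fin n) ℂ ^ (k + 1) := by
  induction k with
  | zero =>
    intro b hb
    rw [Finsupp.degree_eq_zero_iff] at hb
    subst hb
    simp [aeval_monomial]
  | succ k ih =>
    intro b hb
    have hb0 : b ≠ 0 := by rintro rfl; simp at hb
    obtain ⟨i, hi⟩ := Finsupp.ne_iff.mp hb0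
    obtain ⟨b', rfl⟩ := exists_single_add b i hi
    rw [map_add, Finsupp.degree_single] at hb
    have hb' : Finsupp.degree b' = k := by omega
    have hm : monomial (Finsupp.single i 1 + b') (1 : ℂ) = X i * monomial b' 1 := by
      rw [X, monomial_mul, one_mul]
    have e : aeval f₁ (X i * monomial b' (1 : ℂ)) - aeval f₂ (X i * monomial b' (1 : ℂ)) =
        f₁ i * (aeval f₁ (monomial b' (1 : ℂ)) - aeval f₂ (monomial b' (1 : ℂ))) +
        (f₁ i - f₂ i) * aeval f₂ (monomial b' (1 : ℂ)) := by
      simp only [map_mul, aeval_X]; ring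
    rw [hm, e]
    apply Ideal.add_mem
    · rw [pow_succ']
      exact Ideal.mul_mem_mul (h₁ i) (ih b' hb')
    · have : k + 1 + 1 = 2 + k := by ring
      rw [this, pow_add]
      refine Ideal.mul_mem_mul (h i) (aeval_mem_pow f₂ h₂ k _ ?_)
      rw [monomial_mem_pow_idealOfVars_iff _ _ one_ne_zero, hb']

lemma aeval_diff (f₁ f₂ : Fin n → MvPolynomial (Fin n) ℂ)
    (h₁ : ∀ i, f₁ i ∈ idealOfVars (Fin n) ℂ) (h₂ : ∀ i, f₂ i ∈ idealOfVars (Fin n) ℂ)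
    (h : ∀ i, f₁ i - f₂ i ∈ idealOfVars (Fin n) ℂ ^ 2) (k : ℕ) (Q : MvPolynomial (Fin n) ℂ)
    (hQ : Q ∈ idealOfVars (Fin n) ℂ ^ k) :
    aeval f₁ Q - aeval f₂ Q ∈ idealOfVars (Fin n) ℂ ^ (k + 1) := by
  rw [Q.as_sum, map_sum, map_sum, ← Finset.sum_sub_distrib]
  apply Ideal.sum_mem
  intro b hb
  have hm : monomial b (coeff b Q) = coeff b Q • monomial b (1 : ℂ) := by
    rw [smul_monomial]; simp
  rw [hm, map_smul, map_smul, ← smul_sub, smul_eq_C_mul]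
  apply Ideal.mul_mem_left
  refine Ideal.pow_le_pow_right ?_ (aeval_diff_monomial f₁ f₂ h₁ h₂ h _ b rfl)
  have := (mem_pow_idealOfVars_iff k Q).mp hQ b hb
  omega

lemma pback_comp (M N : Matrix (Fin n) (Fin n) ℂ) (f : MvPolynomial (Fin n) ℂ) :
    pback M (pback N f) = pback (N * M) f := by
  apply MvPolynomial.funext
  intro v
  simp [eval_pback, Matrix.mulVec_mulVec]

lemma rowForm_mem (M : Matrix (Fin n) (Fin n) ℂ) (i : Fin n) :
    rowForm M i ∈ idealOfVars (Fin n) ℂ := by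
  apply Ideal.sum_mem
  intro j _
  exact Ideal.mul_mem_left _ _ (Ideal.subset_span ⟨j, rfl⟩)

lemma pback_eq (M : Matrix (Fin n) (Fin n) ℂ) : pback M = aeval (rowForm M) := rfl

lemma core_inj (d : Fin n → ℕ) (hd : ∀ i, 0 < d i) (D : ℕ)
    (w : Fin n → MvPolynomial (Fin n) ℂ)
    (hc : ∀ i, d i < D → coeff 0 (w i) = 0)
    (hl : ∀ i j, coeff (Finsupp.single j 1) (w i) ≠ 0 → d i = d j)
    (hdet : (Matrix.of fun i j => coeff (Finsupp.single j 1) (w i)).det ≠ 0)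
    (Q : MvPolynomial (Fin n) ℂ) (hQ : ∀ b ∈ Q.support, b ∈ idx d D)
    (h0 : ∀ a ∈ idx d D, coeff a (aeval w Q) = 0) : Q = 0 := by
  classical
  set J : Matrix (Fin n) (Fin n) ℂ := Matrix.of fun i j => coeff (Finsupp.single j 1) (w i) with hJ
  let w' : Fin n → MvPolynomial (Fin n) ℂ := fun i => w i - C (coeff 0 (w i))
  have hww : aeval w Q = aeval w' Q := by
    refine eval₂Hom_congr' rfl (fun i hi _ => ?_) rfl
    obtain ⟨b, hb, hbi⟩ := (mem_vars i).mp hi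
    have := hc i (idx_lt d hd D b (hQ b hb) i (Finsupp.mem_support_iff.mp hbi))
    simp [w', this]
  have hw'1 : ∀ i, w' i ∈ idealOfVars (Fin n) ℂ := by
    intro i
    rw [← pow_one (idealOfVars (Fin n) ℂ), mem_pow_idealOfVars_iff']
    intro a ha
    rw [Nat.lt_one_iff, Finsupp.degree_eq_zero_iff] at ha
    subst ha
    simp [w']
  have hw'2 : ∀ i, w' i - rowForm J i ∈ idealOfVars (Fin n) ℂ ^ 2 := by
    intro i
    rw [mem_pow_idealOfVars_iff']
    intro a ha
    have : Finsupp.degree a = 0 ∨ Finsupp.degree a = 1 := by omega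
    rcases this with h | h
    · rw [Finsupp.degree_eq_zero_iff] at h
      subst h
      have : coeff 0 (rowForm J i) = 0 := by simp [rowForm, coeff_sum]
      simp [w', this]
    · have : a ∈ Set.range (fun j : Fin n => Finsupp.single j 1) := by
        rw [Finsupp.range_single_one]; exact h
      obtain ⟨j, rfl⟩ := this
      simp only [coeff_sub, coeff_rowForm, w', coeff_C]
      rw [if_neg]
      · simp [hJ]
      · intro h
        have := congrArg Finsupp.degree h
        simp at this
  have hhom : IsWeightedHomogeneous d (aeval (rowForm J) Q) D := by
    apply whom_aeval d d D _ _ Q (fun b hb => (hQ b hb).1)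
    intro i
    apply IsWeightedHomogeneous.sum
    intro j _
    by_cases hz : J i j = 0
    · rw [hz, C_0, zero_mul]; exact isWeightedHomogeneous_zero _ _ _
    · rw [hl i j hz]
      simpa using (isWeightedHomogeneous_C d (J i j)).mul (isWeightedHomogeneous_X ℂ d j)
  have hQ2 : Q ∈ idealOfVars (Fin n) ℂ ^ 2 := by
    rw [mem_pow_idealOfVars_iff]
    exact fun b hb => (hQ b hb).2
  have hord := aeval_mem_pow (rowForm J) (rowForm_mem J) 2 Q hQ2
  rw [mem_pow_idealOfVars_iff'] at hord
  have hstep : ∀ k, Q ∈ idealOfVars (Fin n) ℂ ^ k := by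
    intro k
    induction k with
    | zero => simp
    | succ k ih =>
      have h1 := aeval_diff w' (rowForm J) hw'1 (rowForm_mem J) hw'2 k Q ih
      rw [mem_pow_idealOfVars_iff'] at h1
      have h2 : aeval (rowForm J) Q ∈ idealOfVars (Fin n) ℂ ^ (k + 1) := by
        rw [mem_pow_idealOfVars_iff']
        intro a ha
        by_cases hai : a ∈ idx d D
        · have := h1 a ha
          rw [coeff_sub, ← hww, h0 a hai, zero_sub, neg_eq_zero] at this
          exact this
        · by_cases hwt : Finsupp.weight d a = D
          · apply hord
            by_contra hlt
            exact hai ⟨hwt, by omega⟩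
          · exact hhom.coeff_eq_zero a hwt
      have h3 := aeval_mem_pow (rowForm J⁻¹) (rowForm_mem _) _ _ h2
      rw [← pback_eq, ← pback_eq, pback_comp, Matrix.mul_nonsing_inv _ (isUnit_iff_ne_zero.mpr hdet)] at h3
      have h4 : pback (1 : Matrix (Fin n) (Fin n) ℂ) Q = Q := by
        apply MvPolynomial.funext
        intro v
        simp [eval_pback]
      rwa [h4] at h3
  ext a
  rw [coeff_zero]
  exact (mem_pow_idealOfVars_iff' _ _).mp (hstep (Finsupp.degree a + 1)) a (Nat.lt_succ_self _)

lemma core_surj (d : Fin n → ℕ) (hd : ∀ i, 0 < d i) (D : ℕ)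
    (w : Fin n → MvPolynomial (Fin n) ℂ)
    (hc : ∀ i, d i < D → coeff 0 (w i) = 0)
    (hl : ∀ i j, coeff (Finsupp.single j 1) (w i) ≠ 0 → d i = d j)
    (hdet : (Matrix.of fun i j => coeff (Finsupp.single j 1) (w i)).det ≠ 0)
    (F : MvPolynomial (Fin n) ℂ) :
    ∃ Q : MvPolynomial (Fin n) ℂ, (∀ b ∈ Q.support, b ∈ idx d D) ∧
      ∀ a ∈ idx d D, coeff a (aeval w Q) = coeff a F := by
  classical
  have := (idx_finite d hd D).fintype
  let mk : (idx d D → ℂ) →ₗ[ℂ] MvPolynomial (Fin n) ℂ :=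
    ∑ b : idx d D, (monomial b.1).comp (LinearMap.proj b)
  have hmk : ∀ c, mk c = ∑ b : idx d D, monomial b.1 (c b) := by
    intro c; simp [mk, LinearMap.sum_apply]
  have hco : ∀ c (b : idx d D), coeff b.1 (mk c) = c b := by
    intro c b
    rw [hmk, coeff_sum, Finset.sum_eq_single b]
    · simp
    · intro b' _ hb'
      rw [coeff_monomial, if_neg (fun h => hb' (Subtype.ext h))]
    · simp
  have hsupp : ∀ c, ∀ b ∈ (mk c).support, b ∈ idx d D := by
    intro c b hb
    by_contra hbn
    rw [mem_support_iff, hmk, coeff_sum] at hb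
    apply hb
    apply Finset.sum_eq_zero
    intro b' _
    rw [coeff_monomial, if_neg]
    rintro rfl
    exact hbn b'.2
  let Φ : (idx d D → ℂ) →ₗ[ℂ] (idx d D → ℂ) :=
    LinearMap.pi fun a => (lcoeff ℂ a.1).comp ((aeval w).toLinearMap.comp mk)
  have hΦ : ∀ c a, Φ c a = coeff a.1 (aeval w (mk c)) := fun c a => rfl
  have hinj : Function.Injective Φ := by
    rw [injective_iff_map_eq_zero]
    intro c hcz
    have := core_inj d hd D w hc hl hdet (mk c) (hsupp c) (by
      intro a ha
      have := congrFun hcz ⟨a, ha⟩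
      rwa [hΦ] at this)
    ext b
    rw [← hco c b, this]; simp
  obtain ⟨c, hcF⟩ := LinearMap.injective_iff_surjective.mp hinj (fun a => coeff a.1 F)
  refine ⟨mk c, hsupp c, fun a ha => ?_⟩
  have := congrFun hcF ⟨a, ha⟩
  rwa [hΦ] at this

lemma injective_of_surj (ψ : MvPolynomial (Fin n) ℂ →ₐ[ℂ] MvPolynomial (Fin n) ℂ)
    (h : Function.Surjective ψ) : Function.Injective ψ := by
  rw [injective_iff_map_eq_zero]
  intro y hy
  let K : ℕ →o Ideal (MvPolynomial (Fin n) ℂ) :=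
    ⟨fun k => RingHom.ker (ψ ^ k), by
      apply monotone_nat_of_le_succ
      intro k z hz
      rw [RingHom.mem_ker] at hz ⊢
      rw [pow_succ', AlgHom.mul_apply, hz, map_zero]⟩
  obtain ⟨N, hN⟩ := monotone_stabilizes_iff_noetherian.mpr
    (inferInstance : IsNoetherian (MvPolynomial (Fin n) ℂ) (MvPolynomial (Fin n) ℂ)) K
  have hs : Function.Surjective (ψ ^ N) := by
    rw [AlgHom.coe_pow]
    exact h.iterate N
  obtain ⟨z, rfl⟩ := hs y
  have h1 : z ∈ K (N + 1) := by
    change (ψ ^ (N + 1)) z = 0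
    rw [pow_succ', AlgHom.mul_apply, hy]
  rw [← hN (N + 1) (Nat.le_succ N)] at h1
  exact h1

lemma basic_of_corr (G : Subgroup (GL (Fin n) ℂ)) (d : Fin n → ℕ)
    (x : Fin n → MvPolynomial (Fin n) ℂ) (hx : BasicInvariants G d x)
    (Q : Fin n → MvPolynomial (Fin n) ℂ) (hQ : ∀ α, ∀ b ∈ (Q α).support, b ∈ idx d (d α)) :
    BasicInvariants G d (fun α => x α - aeval x (Q α)) := by
  let ψ : MvPolynomial (Fin n) ℂ →ₐ[ℂ] MvPolynomial (Fin n) ℂ := aeval fun α => X α - Q α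
  have hψX : ∀ N α, d α = N → X α ∈ ψ.range := by
    intro N
    induction N using Nat.strong_induction_on with
    | _ N ih =>
      intro α hα
      have h1 : Q α ∈ ψ.range := by
        rw [(Q α).as_sum]
        apply Subalgebra.sum_mem
        intro b hb
        rw [monomial_eq, ← MvPolynomial.algebraMap_eq]
        apply Subalgebra.mul_mem
        · exact Subalgebra.algebraMap_mem _ _
        · apply Subalgebra.prod_mem
          intro i hi
          apply Subalgebra.pow_mem
          exact ih (d i) (hα ▸ idx_lt d hx.pos _ b (hQ α b hb) i (Finsupp.mem_support_iff.mp hi)) i rfl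
      have h2 : X α - Q α ∈ ψ.range := ⟨X α, by simp [ψ]⟩
      simpa using Subalgebra.add_mem _ h2 h1
  have hψ : Function.Surjective ψ := by
    rw [← AlgHom.range_eq_top, eq_top_iff, ← MvPolynomial.adjoin_range_X, Algebra.adjoin_le_iff]
    rintro _ ⟨α, rfl⟩
    exact hψX _ α rfl
  have hcomp : (aeval fun α => x α - aeval x (Q α)) = (aeval x).comp ψ := by
    apply MvPolynomial.algHom_ext
    intro α
    simp [ψ]
  refine ⟨hx.pos, ?_, ?_, ?_, ?_⟩
  · intro α
    refine IsWeightedHomogeneous.sub (hx.homog α) ?_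
    exact whom_aeval d 1 (d α) x hx.homog (Q α) (fun b hb => (hQ α b hb).1)
  · intro g hg α
    have : (pback g.val).comp (aeval x) = aeval x := by
      apply MvPolynomial.algHom_ext
      intro β
      simp [hx.invariant g hg β]
    rw [map_sub, hx.invariant g hg, ← AlgHom.comp_apply, this]
  · have h1 : Function.Injective (aeval x : MvPolynomial (Fin n) ℂ →ₐ[ℂ] _) := hx.indep
    change Function.Injective (aeval fun α => x α - aeval x (Q α))
    rw [hcomp]
    exact h1.comp (injective_of_surj ψ hψ)
  · intro F hF
    have h1 := hx.gen F hF
    rw [Algebra.adjoin_range_eq_range_aeval] at h1 ⊢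
    obtain ⟨R, rfl⟩ := h1
    obtain ⟨S, rfl⟩ := hψ R
    exact ⟨S, by rw [hcomp]; rfl⟩

theorem stmt_8 [NeZero n] (G : Subgroup (GL (Fin n) ℂ)) (hG : IsReflectionGroup G)
    (d : Fin n → ℕ) (hd : Antitone d)
    (x₀ : Fin n → MvPolynomial (Fin n) ℂ) (hx₀ : BasicInvariants G d x₀)
    (g : GL (Fin n) ℂ) (ζ : ℂ) (q : Fin n → ℂ) (hT : AdmissibleTriplet G d g ζ q)
    (P : GL (Fin n) ℂ) (hP : GradedCoords g ζ d P) :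
    ∃ x : Fin n → MvPolynomial (Fin n) ℂ, BasicInvariants G d x ∧ IsGood P q d x := by
  classical
  have := hG.1
  have hcor : ∀ α, ∃ Q : MvPolynomial (Fin n) ℂ, (∀ b ∈ Q.support, b ∈ idx d (d α)) ∧
      ∀ a ∈ idx d (d α), coeff a (aeval (fun β => taylor P q (x₀ β)) Q) =
        coeff a (taylor P q (x₀ α)) := by
    intro α
    apply core_surj d hx₀.pos
    · intro β hβ
      exact taylor_const G d x₀ hx₀ g ζ q hT P β (hβ.trans_le (hd (Fin.zero_le α)))
    · intro β γ h
      exact taylor_linear G d hd x₀ hx₀ g ζ q hT P hP β γ h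
    · exact taylor_det G d x₀ hx₀ q hT.regq P
  choose Q hQ hQc using hcor
  refine ⟨fun α => x₀ α - aeval x₀ (Q α), basic_of_corr G d x₀ hx₀ Q hQ, ?_⟩
  intro α a ha1 ha2
  obtain ⟨b, rfl⟩ : ∃ b : Fin n →₀ ℕ, a = b := ⟨Finsupp.equivFunOnFinite.symm a, rfl⟩
  apply zderivAt_eq_zero
  have hb : b ∈ idx d (d α) := by
    refine ⟨?_, ?_⟩
    · rw [Finsupp.weight_eq_sum]; simpa using ha1
    · rwa [Finsupp.degree_eq_sum]
  have hcomp : (taylor P q).comp (aeval x₀) = aeval fun β => taylor P q (x₀ β) := by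
    apply MvPolynomial.algHom_ext
    intro β
    simp
  rw [map_sub, ← AlgHom.comp_apply, hcomp, coeff_sub, hQc α b hb, sub_self]

end
end

section
/- Let $G$ be a duality group with admissible triplet $(g,\zeta,q)$, $z$ a $(g,\zeta)$-graded coordinate system, and $x$ a set of good basic invariants compatible with $z$ at $q$. Let $J^\gamma_\beta = \partial x^\gamma/\partial z^\beta$ be the Jacobian and $\tilde{J} = J^{-1}$. Then for any nonzero multi-index $a$ with $a \cdot d + d_\beta = d_\gamma + d_1$, one has $\frac{\partial^a \tilde{J}^\gamma_\beta}{\partial z^a}(q) = -\frac{\partial^a J^\gamma_\beta}{\partial z^a}(q)$; moreover $J(q) = \tilde{J}(q) = I$. -/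
open MvPolynomial Matrix

noncomputable section

variable {n : ℕ}

/-! ### Iterated directional derivatives along lists -/

def cdir (i : Fin n) (f : (Fin n → ℂ) → ℂ) : (Fin n → ℂ) → ℂ :=
  fun v => fderiv ℂ f v (Pi.single i 1)

def listD (l : List (Fin n)) (f : (Fin n → ℂ) → ℂ) : (Fin n → ℂ) → ℂ :=
  l.foldr cdir f

def polyD (l : List (Fin n)) (F : MvPolynomial (Fin n) ℂ) : MvPolynomial (Fin n) ℂ :=
  l.foldr (fun i p => pderiv i p) F

def idxList (a : Fin n → ℕ) : List (Fin n) :=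
  (List.finRange n).flatMap fun i => List.replicate (a i) i

lemma foldr_iter {α : Type*} (op : Fin n → α → α) (a : Fin n → ℕ) (L : List (Fin n)) (x : α) :
    L.foldr (fun i acc => (op i)^[a i] acc) x
      = (L.flatMap fun i => List.replicate (a i) i).foldr op x := by
  induction L with
  | nil => rfl
  | cons i L ih =>
    have h : ∀ (k : ℕ) (y : α), (op i)^[k] y = (List.replicate k i).foldr op y := by
      intro k y
      induction k with
      | zero => rfl
      | succ k ihk => rw [Function.iterate_succ_apply', ihk, List.replicate_succ]; rfl
    rw [List.foldr_cons, List.flatMap_cons, List.foldr_append, ih, h]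

lemma mpd_eq (a : Fin n → ℕ) (f : (Fin n → ℂ) → ℂ) : mpd a f = listD (idxList a) f :=
  foldr_iter cdir a _ f

lemma mderiv_eq (a : Fin n → ℕ) (F : MvPolynomial (Fin n) ℂ) :
    mderiv a F = polyD (idxList a) F :=
  foldr_iter (fun i p => pderiv i p) a _ F

lemma sum_map_idxList (a d : Fin n → ℕ) :
    ((idxList a).map d).sum = ∑ α, a α * d α := by
  have : ∀ L : List (Fin n), ((L.flatMap fun i => List.replicate (a i) i).map d).sum
      = (L.map fun i => a i * d i).sum := by
    intro L
    induction L with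
    | nil => rfl
    | cons i L ih => simp [List.flatMap_cons, ih]
  rw [idxList, this, Fin.sum_univ_def]

lemma idxList_perm (l : List (Fin n)) : (idxList fun i => l.count i).Perm l := by
  rw [List.perm_iff_count]
  intro j
  have h : ∀ L : List (Fin n), (L.flatMap fun i => List.replicate (l.count i) i).count j
      = (L.map fun i => if i = j then l.count j else 0).sum := by
    intro L
    induction L with
    | nil => rfl
    | cons i L ih =>
      rw [List.flatMap_cons, List.count_append, ih, List.map_cons, List.sum_cons,
        List.count_replicate]
      by_cases hij : i = j <;> simp [hij]
  rw [idxList, h, ← Fin.sum_univ_def]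
  simp

lemma pderiv_comm' (i j : Fin n) (F : MvPolynomial (Fin n) ℂ) :
    pderiv i (pderiv j F) = pderiv j (pderiv i F) := by
  have h : ⁅(pderiv i : Derivation ℂ (MvPolynomial (Fin n) ℂ) (MvPolynomial (Fin n) ℂ)),
      (pderiv j : Derivation ℂ (MvPolynomial (Fin n) ℂ) (MvPolynomial (Fin n) ℂ))⁆ = 0 := by
    apply MvPolynomial.derivation_ext
    intro k
    rw [Derivation.commutator_apply, pderiv_X, pderiv_X]
    by_cases h1 : j = k <;> by_cases h2 : i = k <;> simp [Pi.single_apply, h1, h2, eq_comm]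
  have := congrArg (fun D => D F) h
  simp only [Derivation.commutator_apply] at this
  exact sub_eq_zero.mp this

lemma polyD_perm {l l' : List (Fin n)} (h : l.Perm l') (F : MvPolynomial (Fin n) ℂ) :
    polyD l F = polyD l' F := by
  have : LeftCommutative
      (fun (i : Fin n) (p : MvPolynomial (Fin n) ℂ) => pderiv i p) :=
    ⟨fun i j F => pderiv_comm' i j F⟩
  exact h.foldr_eq F

lemma eval_differentiable (F : MvPolynomial (Fin n) ℂ) (v : Fin n → ℂ) :
    DifferentiableAt ℂ (fun v : Fin n → ℂ => eval v F) v :=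
  (AnalyticOnNhd.eval_mvPolynomial F v (Set.mem_univ v)).differentiableAt

lemma cdir_eval (i : Fin n) (F : MvPolynomial (Fin n) ℂ) :
    cdir i (fun v => eval v F) = fun v => eval v (pderiv i F) := by
  funext v
  unfold cdir
  induction F using MvPolynomial.induction_on with
  | C c => simp
  | add p q hp hq =>
    simp only [map_add]
    rw [fderiv_fun_add (eval_differentiable p v) (eval_differentiable q v)]
    simp [hp, hq]
  | mul_X p j hp =>
    simp only [map_mul, eval_X]
    have hx : HasFDerivAt (fun w : Fin n → ℂ => w j)
        (ContinuousLinearMap.proj (R := ℂ) (φ := fun _ : Fin n => ℂ) j) v :=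
      (ContinuousLinearMap.proj (R := ℂ) (φ := fun _ : Fin n => ℂ) j).hasFDerivAt
    rw [fderiv_fun_mul (eval_differentiable p v) hx.differentiableAt, hx.fderiv, pderiv_mul,
      pderiv_X]
    simp only [_root_.add_apply, _root_.smul_apply, hp]
    by_cases hij : i = j
    · subst hij; simp; ring
    · simp [Ne.symm hij]; ring

lemma listD_eval (l : List (Fin n)) (F : MvPolynomial (Fin n) ℂ) :
    listD l (fun v => eval v F) = fun v => eval v (polyD l F) := by
  induction l with
  | nil => rfl
  | cons i l ih =>
    show cdir i (listD l _) = _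
    rw [ih, cdir_eval]; rfl

/-! ### Analytic functions and the order filtration -/

lemma cdir_analytic {q : Fin n → ℂ} {f : (Fin n → ℂ) → ℂ} (hf : AnalyticAt ℂ f q) (i : Fin n) :
    AnalyticAt ℂ (cdir i f) q :=
  ((ContinuousLinearMap.apply ℂ ℂ (Pi.single i (1 : ℂ) : Fin n → ℂ)).analyticAt _).comp hf.fderiv

lemma cdir_congr {q : Fin n → ℂ} {f g : (Fin n → ℂ) → ℂ} (h : f =ᶠ[nhds q] g) (i : Fin n) :
    cdir i f =ᶠ[nhds q] cdir i g := by
  filter_upwards [h.fderiv (𝕜 := ℂ)] with v hv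
  simp [cdir, hv]

lemma listD_congr {q : Fin n → ℂ} {f g : (Fin n → ℂ) → ℂ} (h : f =ᶠ[nhds q] g)
    (l : List (Fin n)) : listD l f =ᶠ[nhds q] listD l g := by
  induction l with
  | nil => exact h
  | cons i l ih => exact cdir_congr ih i

lemma listD_analytic {q : Fin n → ℂ} {f : (Fin n → ℂ) → ℂ} (hf : AnalyticAt ℂ f q)
    (l : List (Fin n)) : AnalyticAt ℂ (listD l f) q := by
  induction l with
  | nil => exact hf
  | cons i l ih => exact cdir_analytic ih i

lemma cdir_add {q : Fin n → ℂ} {f g : (Fin n → ℂ) → ℂ} (hf : AnalyticAt ℂ f q)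
    (hg : AnalyticAt ℂ g q) (i : Fin n) : cdir i (f + g) =ᶠ[nhds q] cdir i f + cdir i g := by
  filter_upwards [hf.eventually_analyticAt, hg.eventually_analyticAt] with v h1 h2
  simp [cdir, fderiv_add h1.differentiableAt h2.differentiableAt]

lemma cdir_mul {q : Fin n → ℂ} {f g : (Fin n → ℂ) → ℂ} (hf : AnalyticAt ℂ f q)
    (hg : AnalyticAt ℂ g q) (i : Fin n) :
    cdir i (f * g) =ᶠ[nhds q] cdir i f * g + f * cdir i g := by
  filter_upwards [hf.eventually_analyticAt, hg.eventually_analyticAt] with v h1 h2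
  simp [cdir, fderiv_mul h1.differentiableAt h2.differentiableAt]
  ring

lemma listD_add {q : Fin n → ℂ} {f g : (Fin n → ℂ) → ℂ} (hf : AnalyticAt ℂ f q)
    (hg : AnalyticAt ℂ g q) (l : List (Fin n)) :
    listD l (f + g) =ᶠ[nhds q] listD l f + listD l g := by
  induction l with
  | nil => exact Filter.EventuallyEq.rfl
  | cons i l ih =>
    exact (cdir_congr ih i).trans (cdir_add (listD_analytic hf l) (listD_analytic hg l) i)

lemma listD_neg (f : (Fin n → ℂ) → ℂ) (l : List (Fin n)) : listD l (-f) = - listD l f := by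
  induction l with
  | nil => rfl
  | cons i l ih =>
    show cdir i (listD l (-f)) = _
    rw [ih]
    funext v
    simp [cdir, listD, fderiv_neg]

lemma listD_const (c : ℂ) {l : List (Fin n)} (hl : l ≠ []) (v : Fin n → ℂ) :
    listD l (fun _ => c) v = 0 := by
  have : ∀ l : List (Fin n), ∃ c' : ℂ, listD l (fun _ => c) = fun _ => c' := by
    intro l
    induction l with
    | nil => exact ⟨c, rfl⟩
    | cons i l ih =>
      obtain ⟨c', h⟩ := ih
      refine ⟨0, ?_⟩
      show cdir i (listD l _) = _
      rw [h]; funext v; simp [cdir]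
  cases l with
  | nil => exact absurd rfl hl
  | cons i l =>
    obtain ⟨c', h⟩ := this l
    show cdir i (listD l _) v = 0
    rw [h]; simp [cdir]

/-- Total weight of a list of indices. -/
def wt (d : Fin n → ℕ) (l : List (Fin n)) : ℤ := ((l.map d).sum : ℕ)

structure OrdAt (d : Fin n → ℕ) (q : Fin n → ℂ) (w : ℤ) (f : (Fin n → ℂ) → ℂ) : Prop where
  an : AnalyticAt ℂ f q
  van : ∀ l : List (Fin n), wt d l < w → listD l f q = 0

lemma wt_nonneg (d : Fin n → ℕ) (l : List (Fin n)) : 0 ≤ wt d l := Int.natCast_nonneg _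

lemma OrdAt.of_nonpos {d : Fin n → ℕ} {q : Fin n → ℂ} {w : ℤ} {f : (Fin n → ℂ) → ℂ}
    (hf : AnalyticAt ℂ f q) (hw : w ≤ 0) : OrdAt d q w f :=
  ⟨hf, fun l hl => by have := wt_nonneg d l; omega⟩

lemma OrdAt.congr {d : Fin n → ℕ} {q : Fin n → ℂ} {w : ℤ} {f g : (Fin n → ℂ) → ℂ}
    (hf : OrdAt d q w f) (h : f =ᶠ[nhds q] g) : OrdAt d q w g :=
  ⟨hf.an.congr h, fun l hl => by rw [← (listD_congr h l).self_of_nhds]; exact hf.van l hl⟩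

lemma OrdAt.mono {d : Fin n → ℕ} {q : Fin n → ℂ} {w w' : ℤ} {f : (Fin n → ℂ) → ℂ}
    (hf : OrdAt d q w f) (h : w' ≤ w) : OrdAt d q w' f :=
  ⟨hf.an, fun l hl => hf.van l (by omega)⟩

lemma OrdAt.add {d : Fin n → ℕ} {q : Fin n → ℂ} {w : ℤ} {f g : (Fin n → ℂ) → ℂ}
    (hf : OrdAt d q w f) (hg : OrdAt d q w g) : OrdAt d q w (f + g) :=
  ⟨hf.an.add hg.an, fun l hl => by
    rw [(listD_add hf.an hg.an l).self_of_nhds, Pi.add_apply, hf.van l hl, hg.van l hl, add_zero]⟩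

lemma OrdAt.neg {d : Fin n → ℕ} {q : Fin n → ℂ} {w : ℤ} {f : (Fin n → ℂ) → ℂ}
    (hf : OrdAt d q w f) : OrdAt d q w (-f) :=
  ⟨hf.an.neg, fun l hl => by rw [listD_neg, Pi.neg_apply, hf.van l hl, neg_zero]⟩

lemma OrdAt.zero {d : Fin n → ℕ} {q : Fin n → ℂ} {w : ℤ} : OrdAt d q w (fun _ => 0) :=
  ⟨analyticAt_const, fun l _ => by
    by_cases h : l = []
    · subst h; rfl
    · exact listD_const 0 h q⟩

lemma wt_append_singleton (d : Fin n → ℕ) (l : List (Fin n)) (i : Fin n) :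
    wt d (l ++ [i]) = wt d l + d i := by simp [wt]

lemma listD_append_singleton (l : List (Fin n)) (i : Fin n) (f : (Fin n → ℂ) → ℂ) :
    listD (l ++ [i]) f = listD l (cdir i f) := by simp [listD]

lemma OrdAt.dir {d : Fin n → ℕ} {q : Fin n → ℂ} {w : ℤ} {f : (Fin n → ℂ) → ℂ}
    (hf : OrdAt d q w f) (i : Fin n) : OrdAt d q (w - d i) (cdir i f) :=
  ⟨cdir_analytic hf.an i, fun l hl => by
    rw [← listD_append_singleton]
    exact hf.van _ (by rw [wt_append_singleton]; omega)⟩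

lemma OrdAt.mul {d : Fin n → ℕ} {q : Fin n → ℂ} {w w' : ℤ} {f g : (Fin n → ℂ) → ℂ}
    (hf : OrdAt d q w f) (hg : OrdAt d q w' g) : OrdAt d q (w + w') (f * g) := by
  refine ⟨hf.an.mul hg.an, fun l => ?_⟩
  induction l using List.reverseRecOn generalizing f g w w' with
  | nil =>
    intro hl
    have h0 : wt d ([] : List (Fin n)) = 0 := rfl
    show f q * g q = 0
    rcases lt_or_ge 0 w with h | h
    · rw [show f q = 0 from hf.van [] (by omega), zero_mul]
    · rw [show g q = 0 from hg.van [] (by omega), mul_zero]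
  | append_singleton l i ih =>
    intro hl
    rw [wt_append_singleton] at hl
    rw [listD_append_singleton, (listD_congr (cdir_mul hf.an hg.an i) l).self_of_nhds,
      (listD_add ((hf.dir i).an.mul hg.an) (hf.an.mul (hg.dir i).an) l).self_of_nhds,
      Pi.add_apply, ih (hf.dir i) hg (by omega), ih hf (hg.dir i) (by omega), add_zero]

lemma OrdAt.sum {d : Fin n → ℕ} {q : Fin n → ℂ} {w : ℤ} {ι : Type*} (s : Finset ι)
    {f : ι → (Fin n → ℂ) → ℂ} (hf : ∀ i ∈ s, OrdAt d q w (f i)) : OrdAt d q w (∑ i ∈ s, f i) := by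
  classical
  induction s using Finset.induction_on with
  | empty => rw [Finset.sum_empty]; exact OrdAt.zero
  | insert i s hi ih =>
    rw [Finset.sum_insert hi]
    exact (hf i (Finset.mem_insert_self i s)).add
      (ih fun j hj => hf j (Finset.mem_insert_of_mem hj))

/-! ### Pullbacks and weighted homogeneity -/

lemma pback_X (M : Matrix (Fin n) (Fin n) ℂ) (i : Fin n) :
    pback M (X i) = ∑ j, C (M i j) * X j := by simp [pback]

lemma pback_pback (M N : Matrix (Fin n) (Fin n) ℂ) (F : MvPolynomial (Fin n) ℂ) :
    pback M (pback N F) = pback (N * M) F := by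
  have h : (pback M).comp (pback N) = pback (N * M) := by
    apply MvPolynomial.algHom_ext
    intro i
    rw [AlgHom.comp_apply, pback_X, pback_X, map_sum]
    simp only [map_mul, pback_X, Matrix.mul_apply, map_sum, Finset.sum_mul, Finset.mul_sum]
    rw [Finset.sum_comm]
    refine Finset.sum_congr rfl fun j _ => Finset.sum_congr rfl fun k _ => ?_
    rw [← MvPolynomial.algebraMap_eq, AlgHom.commutes, mul_assoc]
  rw [← h]; rfl

lemma coeff_pback_diagonal (c : Fin n → ℂ) (F : MvPolynomial (Fin n) ℂ) (b : Fin n →₀ ℕ) :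
    coeff b (pback (Matrix.diagonal c) F) = (∏ i, c i ^ b i) * coeff b F := by
  have hX : ∀ i, ∑ j, C (Matrix.diagonal c i j) * X j = (C (c i) * X i : MvPolynomial (Fin n) ℂ) := by
    intro i
    rw [Finset.sum_eq_single i]
    · simp
    · intro j _ hj; simp [Matrix.diagonal_apply_ne _ hj.symm]
    · simp
  induction F using MvPolynomial.induction_on' with
  | monomial u r =>
    rw [pback, aeval_monomial]
    simp only [hX]
    rw [Finsupp.prod_fintype _ _ (by simp)]
    simp only [mul_pow, Finset.prod_mul_distrib, ← map_pow, ← map_prod]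
    rw [← Finsupp.prod_fintype u (fun i k => (X i : MvPolynomial (Fin n) ℂ) ^ k) (by simp)]
    rw [MvPolynomial.algebraMap_eq, ← mul_assoc, ← C_mul, ← monomial_eq, coeff_monomial,
      coeff_monomial]
    split_ifs with h
    · subst h; ring
    · simp
  | add p q hp hq => rw [map_add, coeff_add, hp, hq, coeff_add, mul_add]

lemma coeff_lin (a : Fin n → ℂ) (j : Fin n) :
    coeff (Finsupp.single j 1) (∑ k, C (a k) * X k : MvPolynomial (Fin n) ℂ) = a j := by
  rw [coeff_sum]
  simp only [coeff_C_mul, coeff_X]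
  rw [Finset.sum_eq_single j]
  · simp
  · intro k _ hk
    rw [if_neg, mul_zero]
    intro h
    exact hk (Finsupp.single_left_injective one_ne_zero h)
  · simp

lemma graded_matrix {g : GL (Fin n) ℂ} {ζ : ℂ} {d : Fin n → ℕ} {P : GL (Fin n) ℂ}
    (hP : GradedCoords g ζ d P) :
    P.val * (g⁻¹).val = Matrix.diagonal (fun α => ζ ^ ((d α : ℤ) - 1)) * P.val := by
  ext α j
  have h := hP α
  have h1 : coordPoly P α = pback P.val (X α) := (pback_X _ _).symm
  rw [h1, pback_pback, pback_X, pback_X] at h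
  have h2 := congrArg (coeff (Finsupp.single j 1)) h
  rw [coeff_lin, coeff_C_mul, coeff_lin] at h2
  rw [h2, Matrix.diagonal_mul]

section key
variable [NeZero n] {G : Subgroup (GL (Fin n) ℂ)} {d : Fin n → ℕ}
    {x : Fin n → MvPolynomial (Fin n) ℂ} {g : GL (Fin n) ℂ} {ζ : ℂ} {q : Fin n → ℂ}
    {P : GL (Fin n) ℂ}

lemma coord_zero (hd1 : ∀ α : Fin n, α ≠ 0 → d α < d 0)
    (hx : BasicInvariants G d x) (hT : AdmissibleTriplet G d g ζ q)
    (hP : GradedCoords g ζ d P) (α : Fin n) (hα : α ≠ 0) : (P.val *ᵥ q) α = 0 := by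
  have hζ : ζ ≠ 0 := hT.prim.ne_zero (hx.pos 0).ne'
  have h1 : (g⁻¹).val *ᵥ (g.val *ᵥ q) = q := by
    rw [Matrix.mulVec_mulVec, ← Units.val_mul, inv_mul_cancel, Units.val_one, Matrix.one_mulVec]
  rw [hT.eig, Matrix.mulVec_smul] at h1
  have h2 : P.val *ᵥ q = ζ • (Matrix.diagonal (fun α => ζ ^ ((d α : ℤ) - 1)) *ᵥ (P.val *ᵥ q)) := by
    conv_lhs => rw [← h1]
    rw [Matrix.mulVec_smul, Matrix.mulVec_mulVec, graded_matrix hP, ← Matrix.mulVec_mulVec]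
  have h3 := congrFun h2 α
  rw [Pi.smul_apply, Matrix.mulVec_diagonal, smul_eq_mul, ← mul_assoc, zpow_sub_one₀ hζ,
    mul_comm ζ, inv_mul_cancel_right₀ hζ, zpow_natCast] at h3
  by_contra h0
  have h4 : ζ ^ d α = 1 := by
    apply mul_right_cancel₀ h0
    rw [one_mul]; exact h3.symm
  have := Nat.le_of_dvd (hx.pos α) ((hT.prim.pow_eq_one_iff_dvd _).mp h4)
  have := hd1 α hα
  omega

lemma weighted_hom (hx : BasicInvariants G d x) (hT : AdmissibleTriplet G d g ζ q)
    (hP : GradedCoords g ζ d P) (γ : Fin n) :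
    IsWeightedHomogeneous (fun i => (d i : ZMod (d 0))) (pback (P⁻¹).val (x γ))
      (d γ : ZMod (d 0)) := by
  have hζ : ζ ≠ 0 := hT.prim.ne_zero (hx.pos 0).ne'
  set F := pback (P⁻¹).val (x γ) with hF
  have hhom : F.IsHomogeneous (d γ) := by
    have := (hx.homog γ).aeval (n := 1) (fun i => ∑ j, C ((P⁻¹).val i j) * X j)
      (fun i => IsHomogeneous.sum _ _ _ fun j _ => isHomogeneous_C_mul_X _ _)
    rw [one_mul] at this
    exact this
  have hinv : pback (Matrix.diagonal fun α => ζ ^ ((d α : ℤ) - 1)) F = F := by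
    have hm : (P⁻¹).val * Matrix.diagonal (fun α => ζ ^ ((d α : ℤ) - 1))
        = (g⁻¹).val * (P⁻¹).val := by
      calc _ = (P⁻¹).val * (Matrix.diagonal (fun α => ζ ^ ((d α : ℤ) - 1)) * P.val)
              * (P⁻¹).val := by
            rw [Matrix.mul_assoc, Matrix.mul_assoc, ← Units.val_mul, mul_inv_cancel,
              Units.val_one, Matrix.mul_one]
        _ = _ := by
            rw [← graded_matrix hP, ← Matrix.mul_assoc, ← Units.val_mul P⁻¹ P, inv_mul_cancel,
              Units.val_one, Matrix.one_mul]
    rw [hF, pback_pback, hm, ← pback_pback, hx.invariant _ (G.inv_mem hT.reg.1)]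
  intro b hb
  have h1 := congrArg (coeff b) hinv
  rw [coeff_pback_diagonal] at h1
  have h2 : ∏ i, (ζ ^ ((d i : ℤ) - 1)) ^ b i = 1 := mul_right_cancel₀ hb (by rw [h1, one_mul])
  have h3 : ∏ i, (ζ ^ ((d i : ℤ) - 1)) ^ b i = ζ ^ (∑ i, ((d i : ℤ) - 1) * b i) := by
    have : ∀ t : Finset (Fin n), ∏ i ∈ t, (ζ ^ ((d i : ℤ) - 1)) ^ b i
        = ζ ^ (∑ i ∈ t, ((d i : ℤ) - 1) * b i) := by
      intro t
      induction t using Finset.induction_on with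
      | empty => simp
      | insert i t hi ih =>
        rw [Finset.prod_insert hi, Finset.sum_insert hi, zpow_add₀ hζ, ih, _root_.zpow_mul,
          zpow_natCast]
    exact this _
  rw [h3, hT.prim.zpow_eq_one_iff_dvd] at h2
  have h4 : ∑ i, b i = d γ := by
    have := hhom hb
    rw [Finsupp.weight_apply, Finsupp.sum_fintype _ _ (by simp)] at this
    simpa using this
  have h5 := (ZMod.intCast_zmod_eq_zero_iff_dvd _ _).mpr h2
  rw [Finsupp.weight_apply, Finsupp.sum_fintype _ _ (by simp)]
  rw [← h4]
  push_cast at h5 ⊢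
  simp only [sub_mul, one_mul, Finset.sum_sub_distrib, sub_eq_zero] at h5
  rw [← h5]
  exact Finset.sum_congr rfl fun i _ => by rw [nsmul_eq_mul, mul_comm]

lemma polyD_weighted {M : Type*} [AddCommGroup M] (w : Fin n → M) (m : M)
    {F : MvPolynomial (Fin n) ℂ} (hF : IsWeightedHomogeneous w F m) (l : List (Fin n)) :
    IsWeightedHomogeneous w (polyD l F) (m - (l.map w).sum) := by
  induction l with
  | nil => simpa [polyD] using hF
  | cons i l ih =>
    exact ih.pderiv (by rw [List.map_cons, List.sum_cons]; abel)

lemma eval_weighted {M : Type*} [AddCommGroup M] (w : Fin n → M) (hw : w 0 = 0) {m : M}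
    {F : MvPolynomial (Fin n) ℂ} (hF : IsWeightedHomogeneous w F m) {v : Fin n → ℂ}
    (hv : ∀ α, α ≠ 0 → v α = 0) (h : eval v F ≠ 0) : m = 0 := by
  rw [eval_eq'] at h
  obtain ⟨b, hb, hne⟩ := Finset.exists_ne_zero_of_sum_ne_zero h
  have h1 := hF (mem_support_iff.mp hb)
  rw [← h1, Finsupp.weight_apply, Finsupp.sum_fintype _ _ (by simp)]
  refine Finset.sum_eq_zero fun i _ => ?_
  by_cases hi : i = 0
  · rw [hi, hw, smul_zero]
  · have h2 := (Finset.prod_ne_zero_iff.mp (right_ne_zero_of_mul hne)) i (Finset.mem_univ i)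
    rw [hv i hi] at h2
    have : b i = 0 := by
      by_contra h3
      exact h2 (zero_pow h3)
    rw [this, zero_smul]

lemma jac_ord (hd : Antitone d) (hd1 : ∀ α : Fin n, α ≠ 0 → d α < d 0)
    (hx : BasicInvariants G d x) (hT : AdmissibleTriplet G d g ζ q)
    (hP : GradedCoords g ζ d P) (hgood : IsGood P q d x) (γ β : Fin n)
    (l : List (Fin n)) (hl : l ≠ []) (hw : wt d l < d 0 + d γ - d β) :
    listD l (jacEntry P x γ β) (P.val *ᵥ q) = 0 := by
  unfold jacEntry
  rw [listD_eval]
  set F := pback (P⁻¹).val (x γ) with hF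
  have h0 : polyD l (pderiv β F) = polyD (l ++ [β]) F := by simp [polyD]
  show eval _ (polyD l (pderiv β F)) = 0
  rw [h0]
  by_contra hne
  have hwt := polyD_weighted _ _ (weighted_hom hx hT hP γ) (l ++ [β])
  have h1 := eval_weighted _ (by simp) hwt (coord_zero hd1 hx hT hP) hne
  have h2 : ((l ++ [β]).map fun i => (d i : ZMod (d 0))).sum
      = (((l ++ [β]).map d).sum : ℕ) := by
    rw [Nat.cast_list_sum, List.map_map]; rfl
  rw [h2, sub_eq_zero, ZMod.natCast_eq_natCast_iff] at h1
  have h3 : ((l ++ [β]).map d).sum < d 0 + d γ := by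
    have := wt_append_singleton d l β
    unfold wt at this hw
    omega
  have hpos : 0 < ((l ++ [β]).map d).sum := by
    have := hx.pos β
    simp; omega
  set s := ((l ++ [β]).map d).sum with hs
  have hγ : d γ ≤ d 0 := hd (Fin.zero_le γ)
  have hγ0 := hx.pos γ
  have hsd : s = d γ := by
    obtain ⟨k, hk⟩ := h1.dvd
    rcases lt_trichotomy k 0 with hk0 | hk0 | hk0
    · nlinarith
    · rw [hk0] at hk; omega
    · nlinarith
  have hperm := idxList_perm (l ++ [β])
  have hz := hgood γ (fun i => (l ++ [β]).count i) (by
      rw [← sum_map_idxList, (hperm.map d).sum_eq, ← hs, hsd]) (by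
      have := sum_map_idxList (fun i => (l ++ [β]).count i) (fun _ => 1)
      simp only [mul_one] at this
      rw [← this, (hperm.map _).sum_eq]
      have := List.length_pos_of_ne_nil hl
      simp; omega)
  rw [zderivAt, mderiv_eq, polyD_perm hperm] at hz
  exact hne hz

end key

lemma RegRat.analytic {v : Fin n → ℂ} {f : (Fin n → ℂ) → ℂ} (h : RegRat v f) :
    AnalyticAt ℂ f v := by
  obtain ⟨p, s, hs, hf⟩ := h
  have hp := AnalyticOnNhd.eval_mvPolynomial p v (Set.mem_univ v)
  have hs' := AnalyticOnNhd.eval_mvPolynomial s v (Set.mem_univ v)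
  refine (hp.div hs' hs).congr ?_
  filter_upwards [hs'.continuousAt.eventually_ne hs] with w hw
  exact (hf w hw).symm

/-- The duality group hypotheses are encoded as in Statement 17. -/
theorem stmt_18 [NeZero n] (G : Subgroup (GL (Fin n) ℂ)) (hG : IsReflectionGroup G)
    (hirr : ∀ W : Submodule ℂ (Fin n → ℂ),
      (∀ g ∈ G, ∀ w ∈ W, ((g : GL (Fin n) ℂ).val *ᵥ w) ∈ W) → W = ⊥ ∨ W = ⊤)
    (d : Fin n → ℕ) (hd : Antitone d) (hd1 : ∀ α : Fin n, α ≠ 0 → d α < d 0)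
    (x : Fin n → MvPolynomial (Fin n) ℂ) (hx : BasicInvariants G d x)
    (g : GL (Fin n) ℂ) (ζ : ℂ) (q : Fin n → ℂ) (hT : AdmissibleTriplet G d g ζ q)
    (P : GL (Fin n) ℂ) (hP : GradedCoords g ζ d P)
    (hgood : IsGood P q d x) (hc : Compatible P q x)
    (Jt : Fin n → Fin n → (Fin n → ℂ) → ℂ)
    (hJtr : ∀ γ β, RegRat (P.val *ᵥ q) (Jt γ β))
    (hJinv : Filter.Eventually (fun v => ∀ γ β : Fin n,
        (∑ ρ, Jt γ ρ v * jacEntry P x ρ β v) = (if γ = β then (1 : ℂ) else 0))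
      (nhds (P.val *ᵥ q))) :
    (∀ γ β : Fin n, jacEntry P x γ β (P.val *ᵥ q) = (if γ = β then (1 : ℂ) else 0)) ∧
    (∀ γ β : Fin n, Jt γ β (P.val *ᵥ q) = (if γ = β then (1 : ℂ) else 0)) ∧
    ∀ (γ β : Fin n) (a : Fin n → ℕ), a ≠ 0 →
      (∑ α, a α * d α) + d β = d γ + d 0 →
      mpd a (Jt γ β) (P.val *ᵥ q) = - mpd a (jacEntry P x γ β) (P.val *ᵥ q) := by
  set Q := P.val *ᵥ q with hQ
  -- value of the Jacobian
  have hJ1 : ∀ γ β : Fin n, jacEntry P x γ β Q = (if γ = β then (1 : ℂ) else 0) := by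
    intro γ β
    rw [← hc γ β, zderivAt, mderiv_eq]
    have h : idxList (unitIdx β) = [β] := by
      have h1 := idxList_perm [β]
      have h2 : (fun i => List.count i [β]) = unitIdx β := by
        funext i
        by_cases hi : i = β
        · simp [unitIdx, hi]
        · simp [unitIdx, hi, List.count_singleton, Ne.symm hi]
      rw [h2] at h1
      exact List.perm_singleton.mp h1
    rw [h]; rfl
  have hJt1 : ∀ γ β : Fin n, Jt γ β Q = (if γ = β then (1 : ℂ) else 0) := by
    intro γ β
    have h := hJinv.self_of_nhds γ β
    simpa [hJ1] using h
  refine ⟨hJ1, hJt1, ?_⟩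
  -- the nilpotent-like part
  let E : Fin n → Fin n → (Fin n → ℂ) → ℂ := fun γ β _ => if γ = β then 1 else 0
  let N : Fin n → Fin n → (Fin n → ℂ) → ℂ := fun γ β => jacEntry P x γ β + -E γ β
  have hEan : ∀ γ β, AnalyticAt ℂ (E γ β) Q := fun γ β => analyticAt_const
  have hJan : ∀ γ β, AnalyticAt ℂ (jacEntry P x γ β) Q := fun γ β =>
    AnalyticOnNhd.eval_mvPolynomial _ Q (Set.mem_univ Q)
  have hJtan : ∀ γ β, AnalyticAt ℂ (Jt γ β) Q := fun γ β => (hJtr γ β).analytic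
  have hN : ∀ γ β, OrdAt d Q (d 0 + d γ - d β) (N γ β) := by
    intro γ β
    refine ⟨(hJan γ β).add (hEan γ β).neg, fun l hl => ?_⟩
    by_cases h : l = []
    · subst h
      show jacEntry P x γ β Q + -(if γ = β then 1 else 0) = 0
      rw [hJ1]; ring
    · rw [(listD_add (hJan γ β) (hEan γ β).neg l).self_of_nhds, Pi.add_apply, listD_neg,
        Pi.neg_apply, listD_const _ h, jac_ord hd hd1 hx hT hP hgood γ β l h hl]
      simp
  have hE : ∀ γ β, OrdAt d Q (d γ - d β) (E γ β) := by
    intro γ β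
    by_cases h : γ = β
    · exact OrdAt.of_nonpos (hEan γ β) (by rw [h]; omega)
    · have : E γ β = fun _ => 0 := by funext v; simp [E, h]
      rw [this]; exact OrdAt.zero
  -- `Jt = E - Jt N`
  let R : Fin n → Fin n → (Fin n → ℂ) → ℂ := fun γ β => ∑ ρ, Jt γ ρ * N ρ β
  have hrec : ∀ γ β, E γ β + -R γ β =ᶠ[nhds Q] Jt γ β := by
    intro γ β
    filter_upwards [hJinv] with v hv
    have h := hv γ β
    simp only [R, N, E, Pi.add_apply, Pi.neg_apply, Finset.sum_apply, Pi.mul_apply, mul_add,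
      Finset.sum_add_distrib, h]
    simp
  have hR : ∀ m : ℤ, (∀ γ ρ, OrdAt d Q (d γ - d ρ - m) (Jt γ ρ)) →
      ∀ γ β, OrdAt d Q (d γ - d β + d 0 - m) (R γ β) := fun m hm γ β =>
    OrdAt.sum _ fun ρ _ => ((hm γ ρ).mul (hN ρ β)).mono (by omega)
  have hJt0 : ∀ γ ρ, OrdAt d Q (d γ - d ρ - (0 : ℤ)) (Jt γ ρ) := by
    intro γ ρ
    have h1 := hR (d 0) (fun γ ρ => OrdAt.of_nonpos (hJtan γ ρ) (by
      have : d γ ≤ d 0 := hd (Fin.zero_le γ)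
      omega)) γ ρ
    exact (((hE γ ρ).mono (by omega)).add ((h1.mono (by omega)).neg)).congr (hrec γ ρ)
  have hR1 := hR 0 hJt0
  let S : Fin n → Fin n → (Fin n → ℂ) → ℂ := fun γ β => ∑ ρ, R γ ρ * N ρ β
  have hS : ∀ γ β, OrdAt d Q (d γ - d β + 2 * d 0) (S γ β) := fun γ β =>
    OrdAt.sum _ fun ρ _ => ((hR1 γ ρ).mul (hN ρ β)).mono (by omega)
  have hfin : ∀ γ β, Jt γ β =ᶠ[nhds Q]
      ((fun _ => 2 * (if γ = β then 1 else 0)) + -jacEntry P x γ β) + S γ β := by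
    intro γ β
    have hall : ∀ᶠ v in nhds Q, ∀ ρ, (E γ ρ + -R γ ρ) v = Jt γ ρ v :=
      Filter.eventually_all.mpr fun ρ => hrec γ ρ
    filter_upwards [hall] with v hv
    have h1 : Jt γ β v = E γ β v - ∑ ρ, Jt γ ρ v * N ρ β v := by
      rw [← hv β]
      simp [R, sub_eq_add_neg]
    have h2 : ∑ ρ, Jt γ ρ v * N ρ β v = N γ β v - S γ β v := by
      simp only [← hv, S, Pi.add_apply, Pi.neg_apply, Finset.sum_apply, Pi.mul_apply, add_mul,
        Finset.sum_add_distrib]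
      simp [E, sub_eq_add_neg]
    rw [h1, h2]
    simp only [N, E, Pi.add_apply, Pi.neg_apply]
    ring
  intro γ β a ha hw
  have hl : idxList a ≠ [] := by
    intro h
    apply ha
    have h1 := sum_map_idxList a (fun _ => 1)
    rw [h] at h1
    simp only [mul_one, List.map_nil, List.sum_nil] at h1
    funext i
    exact (Finset.sum_eq_zero_iff.mp h1.symm) i (Finset.mem_univ i)
  have hwt : wt d (idxList a) < d γ - d β + 2 * d 0 := by
    unfold wt
    rw [sum_map_idxList]
    have := hx.pos 0
    omega
  rw [mpd_eq, mpd_eq, (listD_congr (hfin γ β) _).self_of_nhds,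
    (listD_add (analyticAt_const.add (hJan γ β).neg) (hS γ β).an _).self_of_nhds, Pi.add_apply,
    (listD_add analyticAt_const (hJan γ β).neg _).self_of_nhds, Pi.add_apply,
    listD_const _ hl, (hS γ β).van _ hwt, listD_neg, Pi.neg_apply]
  ring

end
end
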